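/- arXiv:1510.03980 — 15 statements merged into one kernel-verified Lean document; each statement's English description precedes it below -/
import Mathlib

section
/- Let R be a natural number. For natural numbers j define the integers a_{R,j} = C(2R, j) − C(2R, j−1) (binomial coefficients, with the convention C(2R, j−1) = 0 when j = 0), and define the Chebyshev coefficients c_{R,j} by c_{R,j} = a_{R/2, j} if R is even, and c_{R,j} = a_{(R−1)/2, j} + a_{(R−1)/2, j−1} if R is odd (again with the term indexed by j−1 interpreted as 0 when j = 0). Then for every commutative ring and all elements α, β of it, (α + β)^R = Σ_{j=0}^{⌊R/2⌋} c_{R,j} · (α·β)^j · ( Σ_{i=0}^{R−2j} α^i · β^{R−2j−i} ). -/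
/-- The coefficients `a_{R,j} = C(2R, j) - C(2R, j-1)`, with the convention that the
term indexed by `j - 1` is `0` when `j = 0`. -/
def aCoeff (R j : ℕ) : ℤ :=
  (Nat.choose (2 * R) j : ℤ) - (if j = 0 then 0 else (Nat.choose (2 * R) (j - 1) : ℤ))

/-- The Chebyshev coefficients `c_{R,j}`. -/
def cCoeff (R j : ℕ) : ℤ :=
  if Even R then aCoeff (R / 2) j
  else aCoeff ((R - 1) / 2) j + (if j = 0 then 0 else aCoeff ((R - 1) / 2) (j - 1))

/-- The ballot number `C(n, j) - C(n, j-1)`, with `C(n, -1) = 0`. -/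
def ballotCoeff (n j : ℕ) : ℤ :=
  (n.choose j : ℤ) - (if j = 0 then 0 else (n.choose (j - 1) : ℤ))

theorem ballotCoeff_zero (n : ℕ) : ballotCoeff n 0 = 1 := by
  simp [ballotCoeff]

theorem ballotCoeff_succ_succ (n j : ℕ) :
    ballotCoeff (n + 1) (j + 1) = ballotCoeff n (j + 1) + ballotCoeff n j := by
  cases j with
  | zero => simp [ballotCoeff]
  | succ j =>
    simp only [ballotCoeff, Nat.add_one_ne_zero, if_false, Nat.add_sub_cancel,
      Nat.choose_succ_succ' n (j + 1), Nat.choose_succ_succ' n j]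
    push_cast
    ring

theorem ballotCoeff_two_mul_add_one (m : ℕ) : ballotCoeff (2 * m + 1) (m + 1) = 0 := by
  simp [ballotCoeff, Nat.choose_symm_half]

theorem cCoeff_eq_ballotCoeff (n j : ℕ) : cCoeff n j = ballotCoeff n j := by
  have a_eq (m k : ℕ) : aCoeff m k = ballotCoeff (2 * m) k := rfl
  obtain ⟨m, rfl | rfl⟩ := n.even_or_odd'
  · simp [cCoeff, a_eq]
  · cases j with
    | zero => simp [cCoeff, a_eq, ballotCoeff_zero]
    | succ j => simp [cCoeff, a_eq, ballotCoeff_succ_succ]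

section

variable {A : Type*} [CommRing A] (α β : A)

/-- The normalized Chebyshev polynomial of the second kind `U_{n-1}` at `t = α + β`, `q = α * β`,
with `U_{-1} = 0`. -/
def chebyshevSum (n : ℕ) : A :=
  ∑ i ∈ Finset.range n, α ^ i * β ^ (n - 1 - i)

theorem chebyshevSum_zero : chebyshevSum α β 0 = 0 := by
  simp [chebyshevSum]

theorem chebyshevSum_succ (n : ℕ) :
    chebyshevSum α β (n + 1) = α ^ n + β * chebyshevSum α β n := by
  rw [chebyshevSum, chebyshevSum, Finset.sum_range_succ, Finset.mul_sum, add_comm]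
  congr 1
  · simp
  · refine Finset.sum_congr rfl fun i hi => ?_
    have hi := Finset.mem_range.mp hi
    rw [show n + 1 - 1 - i = n - 1 - i + 1 by omega]
    ring

theorem add_mul_chebyshevSum (n : ℕ) :
    (α + β) * chebyshevSum α β (n + 1) =
      chebyshevSum α β (n + 2) + α * β * chebyshevSum α β n := by
  rw [chebyshevSum_succ α β (n + 1), chebyshevSum_succ α β n]
  ring

theorem add_pow_eq_sum_ballotCoeff (n : ℕ) :
    (α + β) ^ n = ∑ j ∈ Finset.range (n / 2 + 1),
      (ballotCoeff n j : A) * ((α * β) ^ j * chebyshevSum α β (n + 1 - 2 * j)) := by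
  induction n with
  | zero => simp [ballotCoeff_zero, chebyshevSum]
  | succ n ih =>
    have expand : (α + β) ^ (n + 1) =
        ∑ j ∈ Finset.range (n / 2 + 1),
          (ballotCoeff n j : A) * ((α * β) ^ j * chebyshevSum α β (n + 2 - 2 * j)) +
        ∑ j ∈ Finset.range (n / 2 + 1),
          (ballotCoeff n j : A) * ((α * β) ^ (j + 1) * chebyshevSum α β (n - 2 * j)) := by
      rw [pow_succ', ih, Finset.mul_sum, ← Finset.sum_add_distrib]
      refine Finset.sum_congr rfl fun j hj => ?_
      have hj := Finset.mem_range.mp hj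
      rw [show n + 1 - 2 * j = n - 2 * j + 1 by omega,
        show n + 2 - 2 * j = n - 2 * j + 2 by omega]
      linear_combination (ballotCoeff n j : A) * (α * β) ^ j *
        add_mul_chebyshevSum α β (n - 2 * j)
    have last : (ballotCoeff n (n / 2 + 1) : A) * ((α * β) ^ (n / 2 + 1) *
        chebyshevSum α β (n + 2 - 2 * (n / 2 + 1))) = 0 := by
      obtain ⟨m, rfl | rfl⟩ := n.even_or_odd'
      · rw [show 2 * m + 2 - 2 * (2 * m / 2 + 1) = 0 by omega, chebyshevSum_zero]
        simp
      · rw [show (2 * m + 1) / 2 = m by omega, ballotCoeff_two_mul_add_one]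
        simp
    have recombine : (α + β) ^ (n + 1) = ∑ j ∈ Finset.range (n / 2 + 1 + 1),
        (ballotCoeff (n + 1) j : A) *
          ((α * β) ^ j * chebyshevSum α β (n + 2 - 2 * j)) := by
      rw [expand, ← add_zero (Finset.sum (Finset.range (n / 2 + 1)) fun j =>
          (ballotCoeff n j : A) * ((α * β) ^ j * chebyshevSum α β (n + 2 - 2 * j))),
        ← last, ← Finset.sum_range_succ, Finset.sum_range_succ' _ (n / 2 + 1),
        Finset.sum_range_succ' _ (n / 2 + 1),
        add_right_comm, ← Finset.sum_add_distrib, ballotCoeff_zero, ballotCoeff_zero]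
      congr 1
      refine Finset.sum_congr rfl fun j _ => ?_
      rw [ballotCoeff_succ_succ, show n + 2 - 2 * (j + 1) = n - 2 * j by omega]
      push_cast
      ring
    rw [recombine]
    obtain ⟨m, rfl | rfl⟩ := n.even_or_odd'
    · rw [Finset.sum_range_succ, show 2 * m + 2 - 2 * (2 * m / 2 + 1) = 0 by omega,
        chebyshevSum_zero, show (2 * m + 1) / 2 = 2 * m / 2 by omega]
      simp
    · rw [show (2 * m + 1 + 1) / 2 = (2 * m + 1) / 2 + 1 by omega]

end

theorem chebyshev_expansion (R : ℕ) {A : Type*} [CommRing A] (α β : A) :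
    (α + β) ^ R =
      ∑ j ∈ Finset.range (R / 2 + 1),
        (cCoeff R j : A) * ((α * β) ^ j *
          ∑ i ∈ Finset.range (R - 2 * j + 1), α ^ i * β ^ (R - 2 * j - i)) := by
  rw [add_pow_eq_sum_ballotCoeff]
  refine Finset.sum_congr rfl fun j hj => ?_
  have hj := Finset.mem_range.mp hj
  rw [cCoeff_eq_ballotCoeff, show R + 1 - 2 * j = R - 2 * j + 1 by omega, chebyshevSum,
    Nat.add_sub_cancel]
end

section
/- Let ℓ be a prime, q an integer, and B ≤ C natural numbers, and let i be a natural number with C ≤ i ≤ C + B. Suppose D₁, D₂, E₁, E₂ are integers such that ℓ^C divides D₁ − D₂, ℓ^B divides D₁²·q − 1, ℓ^i divides D₁·E₁ − 1, and ℓ^i divides D₂·E₂ − 1. Then ℓ^i divides (D₁·q + E₁) − (D₂·q + E₂). -/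
theorem wellDefined_Dq_add_Dinv (ℓ : ℕ) (hℓ : ℓ.Prime) (q : ℤ) (B C i : ℕ)
    (hBC : B ≤ C) (hCi : C ≤ i) (hiCB : i ≤ C + B)
    (D₁ D₂ E₁ E₂ : ℤ)
    (h1 : (ℓ : ℤ) ^ C ∣ D₁ - D₂)
    (h2 : (ℓ : ℤ) ^ B ∣ D₁ ^ 2 * q - 1)
    (h3 : (ℓ : ℤ) ^ i ∣ D₁ * E₁ - 1)
    (h4 : (ℓ : ℤ) ^ i ∣ D₂ * E₂ - 1) :
    (ℓ : ℤ) ^ i ∣ (D₁ * q + E₁) - (D₂ * q + E₂) := by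
  have hB : (ℓ : ℤ) ^ B ∣ q - E₁ * E₂ := by
    have hd := (pow_dvd_pow (ℓ : ℤ) hBC).trans h1
    have ha := (pow_dvd_pow (ℓ : ℤ) (hBC.trans hCi)).trans h3
    have hb := (pow_dvd_pow (ℓ : ℤ) (hBC.trans hCi)).trans h4
    have key : q - E₁ * E₂ = E₁ * E₂ * (D₁ ^ 2 * q - 1) - E₁ * E₂ * D₁ * q * (D₁ - D₂)
        - (D₂ * E₂ * q * (D₁ * E₁ - 1) + q * (D₂ * E₂ - 1)) := by ring
    rw [key]
    exact ((h2.mul_left _).sub (hd.mul_left _)).sub ((ha.mul_left _).add (hb.mul_left _))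
  have hprod : (ℓ : ℤ) ^ i ∣ (D₁ - D₂) * (q - E₁ * E₂) :=
    (pow_dvd_pow (ℓ : ℤ) hiCB).trans (pow_add (ℓ : ℤ) C B ▸ mul_dvd_mul h1 hB)
  have key : (D₁ * q + E₁) - (D₂ * q + E₂) = (D₁ - D₂) * (q - E₁ * E₂)
      - E₁ * (D₂ * E₂ - 1) + E₂ * (D₁ * E₁ - 1) := by ring
  rw [key]
  exact (hprod.sub (h4.mul_left _)).add (h3.mul_left _)
end

section
/- Let ℓ be a prime, let q and t be integers, and let B ≤ C ≤ i ≤ B + C be natural numbers. Let D be an integer with gcd(D, ℓ) = 1 and ℓ^B ∣ D²·q − 1. Then the following are equivalent: (1) there exists an integer c with ℓ^C ∣ D·c − 1 and ℓ^i ∣ c² − t·c + q; (2) ℓ^i ∣ D²·q + 1 − D·t. Moreover, if these equivalent conditions hold, then every integer c with ℓ^C ∣ D·c − 1 satisfies ℓ^i ∣ c² − t·c + q. -/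
theorem dvd_hecke_polynomial_iff_of_dvd_mul_sub_one {R : Type*} [CommRing R] {p q t D c : R}
    {B C i : ℕ} (hBC : B ≤ C) (hi : i ≤ B + C) (hDq : p ^ B ∣ D ^ 2 * q - 1)
    (hc : p ^ C ∣ D * c - 1) :
    p ^ i ∣ c ^ 2 - t * c + q ↔ p ^ i ∣ D ^ 2 * q + 1 - D * t := by
  have hcop : IsCoprime (p ^ i) (D * c) := by
    obtain ⟨k, hk⟩ := hc
    have h : IsCoprime (p ^ C) (D * c) := ⟨-k, 1, by linear_combination hk⟩
    refine (h.pow_left (m := 2)).of_isCoprime_of_dvd_left ?_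
    rw [← pow_mul]
    exact pow_dvd_pow p (by lia)
  have herr : p ^ i ∣ (D * c - 1) * ((D * c - 1) - (D ^ 2 * q - 1)) := by
    refine (pow_dvd_pow p hi).trans ?_
    rw [add_comm B C, pow_add]
    exact mul_dvd_mul hc (dvd_sub ((pow_dvd_pow p hBC).trans hc) hDq)
  have hkey : D ^ 2 * (c ^ 2 - t * c + q) = (D * c) * (D ^ 2 * q + 1 - D * t) +
      (D * c - 1) * ((D * c - 1) - (D ^ 2 * q - 1)) := by ring
  have hD : IsCoprime (p ^ i) (D ^ 2) := hcop.of_mul_right_left.pow_right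
  have hiff : p ^ i ∣ D ^ 2 * (c ^ 2 - t * c + q) ↔
      p ^ i ∣ (D * c) * (D ^ 2 * q + 1 - D * t) := by
    rw [hkey, dvd_add_left herr]
  exact ⟨fun h => hcop.dvd_of_dvd_mul_left (hiff.1 (h.mul_left _)),
    fun h => hD.dvd_of_dvd_mul_left (hiff.2 (h.mul_left _))⟩

theorem hecke_polynomial_lift_criterion (ℓ : ℕ) (hℓ : ℓ.Prime) (q t : ℤ) (B C i : ℕ)
    (hBC : B ≤ C) (hCi : C ≤ i) (hi : i ≤ B + C)
    (D : ℤ) (hD : Int.gcd D ℓ = 1) (hDq : (ℓ : ℤ) ^ B ∣ D ^ 2 * q - 1) :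
    ((∃ c : ℤ, (ℓ : ℤ) ^ C ∣ D * c - 1 ∧ (ℓ : ℤ) ^ i ∣ c ^ 2 - t * c + q) ↔
      (ℓ : ℤ) ^ i ∣ D ^ 2 * q + 1 - D * t) ∧
    ((ℓ : ℤ) ^ i ∣ D ^ 2 * q + 1 - D * t →
      ∀ c : ℤ, (ℓ : ℤ) ^ C ∣ D * c - 1 → (ℓ : ℤ) ^ i ∣ c ^ 2 - t * c + q) := by
  refine ⟨⟨fun ⟨c, hc, h⟩ =>
    (dvd_hecke_polynomial_iff_of_dvd_mul_sub_one hBC hi hDq hc).1 h, fun h => ?_⟩,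
    fun h c hc => (dvd_hecke_polynomial_iff_of_dvd_mul_sub_one hBC hi hDq hc).2 h⟩
  obtain ⟨a, b, hab⟩ := (Int.isCoprime_iff_gcd_eq_one.2 hD).pow_right (n := C)
  have ha : (ℓ : ℤ) ^ C ∣ D * a - 1 := ⟨-b, by linear_combination hab⟩
  exact ⟨a, ha, (dvd_hecke_polynomial_iff_of_dvd_mul_sub_one hBC hi hDq ha).2 h⟩
end

section
/- Let ℓ be a prime, q a positive integer with ℓ ∤ q, d an integer with gcd(d, ℓ) = 1, and t an integer with t² ≠ 4q. Let γ be a natural number, define β by ℓ^β = gcd(d²q − 1, ℓ^γ), and let ν = v_ℓ(t² − 4q) be the ℓ-adic valuation of t² − 4q. If ν < 2β, then ℓ^{ν+1} does not divide d²·q + 1 − d·t. -/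
theorem residue_class_bound_one (ℓ : ℕ) (hℓ : ℓ.Prime) (q : ℤ) (hqpos : 0 < q)
    (hlq : ¬ (ℓ : ℤ) ∣ q) (d : ℤ) (hd : Int.gcd d ℓ = 1)
    (t : ℤ) (ht : t ^ 2 ≠ 4 * q)
    (γ β : ℕ) (hβ : ℓ ^ β = Int.gcd (d ^ 2 * q - 1) ((ℓ : ℤ) ^ γ))
    (ν : ℕ) (hν : ν = padicValInt ℓ (t ^ 2 - 4 * q))
    (hlt : ν < 2 * β) :
    ¬ (ℓ : ℤ) ^ (ν + 1) ∣ d ^ 2 * q + 1 - d * t := by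
  intro hX
  haveI : Fact ℓ.Prime := ⟨hℓ⟩
  have hβdvd : (ℓ : ℤ) ^ β ∣ d ^ 2 * q - 1 := by
    have h := Int.gcd_dvd_left (d ^ 2 * q - 1) ((ℓ : ℤ) ^ γ)
    rw [← hβ] at h
    exact_mod_cast h
  have hsq : (ℓ : ℤ) ^ (ν + 1) ∣ (d ^ 2 * q - 1) ^ 2 := by
    refine (pow_dvd_pow _ (show ν + 1 ≤ β * 2 by omega)).trans ?_
    rw [pow_mul]
    exact pow_dvd_pow_of_dvd hβdvd 2
  have hdisc : (ℓ : ℤ) ^ (ν + 1) ∣ d ^ 2 * (t ^ 2 - 4 * q) := by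
    have h : d ^ 2 * (t ^ 2 - 4 * q) = (d ^ 2 * q - 1) ^ 2 +
        (d ^ 2 * q + 1 - d * t) * (-(d ^ 2 * q + 1) - d * t) := by ring
    rw [h]
    exact dvd_add hsq (hX.mul_right _)
  have hcop : IsCoprime ((ℓ : ℤ) ^ (ν + 1)) (d ^ 2) :=
    (Int.isCoprime_iff_gcd_eq_one.mpr hd).symm.pow
  rcases (padicValInt_dvd_iff (ν + 1) _).mp (hcop.dvd_of_dvd_mul_left hdisc) with h | h
  · exact ht (sub_eq_zero.mp h)
  · omega
end

section
/- Let q be an odd positive integer, d an odd integer, and t an integer with t² ≠ 4q. Let γ be a natural number, define β by 2^β = gcd(d²q − 1, 2^γ), and let ν = v₂(t² − 4q) be the 2-adic valuation of t² − 4q. If 1 ≤ ν < 2β, then 2^ν does not divide d²·q + 1 − d·t. -/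
theorem residue_class_bound_two (q : ℤ) (hqpos : 0 < q) (hq : Odd q)
    (d : ℤ) (hd : Odd d) (t : ℤ) (ht : t ^ 2 ≠ 4 * q)
    (γ β : ℕ) (hβ : 2 ^ β = Int.gcd (d ^ 2 * q - 1) ((2 : ℤ) ^ γ))
    (ν : ℕ) (hν : ν = padicValInt 2 (t ^ 2 - 4 * q))
    (h1 : 1 ≤ ν) (hlt : ν < 2 * β) :
    ¬ (2 : ℤ) ^ ν ∣ d ^ 2 * q + 1 - d * t := by
  intro hN
  have hu : (2 : ℤ) ^ β ∣ d ^ 2 * q - 1 := by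
    have h := Int.gcd_dvd_left (d ^ 2 * q - 1) ((2 : ℤ) ^ γ)
    rw [← hβ] at h
    exact_mod_cast h
  have hu2 : (2 : ℤ) ^ (ν + 1) ∣ (d ^ 2 * q - 1) ^ 2 :=
    (pow_dvd_pow 2 (by lia : ν + 1 ≤ β * 2)).trans (pow_mul (2 : ℤ) β 2 ▸ pow_dvd_pow_of_dvd hu 2)
  have hN1 : (2 : ℤ) ^ (ν + 1) ∣ (d ^ 2 * q + 1 - d * t) * 2 :=
    pow_succ (2 : ℤ) ν ▸ mul_dvd_mul_right hN 2
  have hN2 : (2 : ℤ) ^ (ν + 1) ∣ (d ^ 2 * q + 1 - d * t) ^ 2 :=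
    (pow_dvd_pow 2 (by lia : ν + 1 ≤ ν * 2)).trans (pow_mul (2 : ℤ) ν 2 ▸ pow_dvd_pow_of_dvd hN 2)
  have hdisc : (2 : ℤ) ^ (ν + 1) ∣ d ^ 2 * (t ^ 2 - 4 * q) := by
    have h : d ^ 2 * (t ^ 2 - 4 * q) =
        (d ^ 2 * q - 1) ^ 2 + (d ^ 2 * q + 1 - d * t) ^ 2 -
          (d ^ 2 * q + 1 - d * t) * 2 * (d ^ 2 * q + 1) := by ring
    rw [h]
    exact dvd_sub (dvd_add hu2 hN2) (hN1.mul_right _)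
  have hcop : IsCoprime ((2 : ℤ) ^ (ν + 1)) (d ^ 2) :=
    (Int.isCoprime_two_left.mpr hd).pow
  have hdvd := hcop.dvd_of_dvd_mul_left hdisc
  rcases (padicValInt_dvd_iff (p := 2) (ν + 1) (t ^ 2 - 4 * q)).mp (by exact_mod_cast hdvd) with h | h
  · exact ht (sub_eq_zero.mp h)
  · lia
end

section
/- Let ℓ be a prime, q a positive integer with ℓ ∤ q, d an integer with gcd(d, ℓ) = 1, and t an integer with t² ≠ 4q. Let γ be a natural number, define β by ℓ^β = gcd(d²q − 1, ℓ^γ), and let ν = v_ℓ(t² − 4q). If β < γ and ν ≠ 2β, then ℓ^{2β+1} does not divide d²·q + 1 − d·t. -/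
theorem padicValInt_pow_mul_of_not_dvd {p : ℕ} (hp : p.Prime) (n : ℕ) {c : ℤ}
    (hc : ¬ (p : ℤ) ∣ c) : padicValInt p ((p : ℤ) ^ n * c) = n := by
  have : Fact p.Prime := ⟨hp⟩
  have hc0 : c ≠ 0 := by
    rintro rfl
    exact hc (dvd_zero _)
  have hp0 : (p : ℤ) ≠ 0 := by exact_mod_cast hp.ne_zero
  rw [padicValInt.mul (pow_ne_zero _ hp0) hc0, padicValInt.eq_zero_of_not_dvd hc, add_zero,
    padicValInt, Int.natAbs_pow, Int.natAbs_natCast, padicValNat.prime_pow]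

theorem exists_eq_pow_mul_not_dvd_of_gcd_eq {p : ℕ} (hp : p.Prime) {m : ℤ} {β γ : ℕ}
    (h : p ^ β = Int.gcd m ((p : ℤ) ^ γ)) (hβγ : β < γ) :
    ∃ a : ℤ, m = (p : ℤ) ^ β * a ∧ ¬ (p : ℤ) ∣ a := by
  have hcast : ((Int.gcd m ((p : ℤ) ^ γ) : ℕ) : ℤ) = (p : ℤ) ^ β := by rw [← h]; push_cast; rfl
  obtain ⟨a, rfl⟩ : (p : ℤ) ^ β ∣ m := hcast ▸ Int.gcd_dvd_left ..
  refine ⟨a, rfl, fun ha => ?_⟩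
  have hdvd : (p : ℤ) ^ (β + 1) ∣ (p : ℤ) ^ β := by
    rw [← hcast]
    refine Int.dvd_coe_gcd ?_ (pow_dvd_pow _ hβγ)
    rw [pow_succ]
    exact mul_dvd_mul_left _ ha
  have hle : p ^ (β + 1) ∣ p ^ β := by exact_mod_cast hdvd
  have := (Nat.pow_dvd_pow_iff_le_right hp.one_lt).mp hle
  omega

theorem residue_class_bound_three (ℓ : ℕ) (hℓ : ℓ.Prime) (q : ℤ) (hqpos : 0 < q)
    (hlq : ¬ (ℓ : ℤ) ∣ q) (d : ℤ) (hd : Int.gcd d ℓ = 1)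
    (t : ℤ) (ht : t ^ 2 ≠ 4 * q)
    (γ β : ℕ) (hβ : ℓ ^ β = Int.gcd (d ^ 2 * q - 1) ((ℓ : ℤ) ^ γ))
    (hβγ : β < γ) (ν : ℕ) (hν : ν = padicValInt ℓ (t ^ 2 - 4 * q)) (hne : ν ≠ 2 * β) :
    ¬ (ℓ : ℤ) ^ (2 * β + 1) ∣ d ^ 2 * q + 1 - d * t := by
  rintro ⟨k, hk⟩
  obtain ⟨a, ha, hna⟩ := exists_eq_pow_mul_not_dvd_of_gcd_eq hℓ hβ hβγ
  have hprime : Prime (ℓ : ℤ) := Nat.prime_iff_prime_int.mp hℓ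
  have hL : (ℓ : ℤ) ^ (2 * β) ≠ 0 := pow_ne_zero _ hprime.ne_zero
  obtain ⟨m, hm⟩ : ∃ m : ℤ,
      d ^ 2 * (t ^ 2 - 4 * q) = (ℓ : ℤ) ^ (2 * β) * (a ^ 2 + ℓ * m) := by
    refine ⟨k * ((ℓ : ℤ) ^ (2 * β + 1) * k - 2 * (d ^ 2 * q + 1)), ?_⟩
    have hdt : d * t = d ^ 2 * q + 1 - (ℓ : ℤ) ^ (2 * β + 1) * k := by linarith
    calc d ^ 2 * (t ^ 2 - 4 * q)
        = (d * t) ^ 2 - 4 * (d ^ 2 * q) := by ring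
      _ = (d ^ 2 * q - 1) ^ 2 + (ℓ : ℤ) ^ (2 * β + 1) * k *
            ((ℓ : ℤ) ^ (2 * β + 1) * k - 2 * (d ^ 2 * q + 1)) := by rw [hdt]; ring
      _ = ((ℓ : ℤ) ^ β * a) ^ 2 + (ℓ : ℤ) ^ (2 * β + 1) * k *
            ((ℓ : ℤ) ^ (2 * β + 1) * k - 2 * (d ^ 2 * q + 1)) := by rw [ha]
      _ = _ := by ring
  have hcop : IsCoprime ((ℓ : ℤ) ^ (2 * β)) (d ^ 2) :=
    (Int.isCoprime_iff_gcd_eq_one.mpr hd).symm.pow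
  obtain ⟨c, hc⟩ : (ℓ : ℤ) ^ (2 * β) ∣ t ^ 2 - 4 * q :=
    hcop.dvd_of_dvd_mul_left ⟨_, hm⟩
  have hdc : d ^ 2 * c = a ^ 2 + ℓ * m := by
    apply mul_left_cancel₀ hL
    rw [← hm, hc]
    ring
  have hnc : ¬ (ℓ : ℤ) ∣ c := fun h =>
    hna <| hprime.dvd_of_dvd_pow <|
      (dvd_add_left (dvd_mul_right (ℓ : ℤ) m)).mp (hdc ▸ h.mul_left (d ^ 2))
  exact hne (by rw [hν, hc, padicValInt_pow_mul_of_not_dvd hℓ _ hnc])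
end

section
/- Let ℓ be a prime, γ ≥ 1 a natural number, q an integer with ℓ ∤ q, and d an integer with gcd(d, ℓ) = 1 and ℓ^γ ∣ d²·q − 1. Let t be an integer with ℓ^{2γ} ∣ d²·q + 1 − d·t. Then for every natural number i ≥ 2γ and every integer c with ℓ^i ∣ c² − t·c + q, one has ℓ^γ ∣ d·c − 1. -/
/-- If a prime power `p ^ (2 * n)` divides a product of two elements congruent modulo `p ^ n`,
then `p ^ n` divides the first of them. -/
theorem Prime.pow_dvd_of_pow_two_mul_dvd_mul {R : Type*} [CommRing R] [IsDomain R]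
    {p a b : R} (hp : Prime p) {n : ℕ} (hab : p ^ n ∣ a - b) (h : p ^ (2 * n) ∣ a * b) :
    p ^ n ∣ a := by
  suffices ∀ j ≤ n, p ^ j ∣ a from this n le_rfl
  intro j
  induction j with
  | zero => simp
  | succ j ih =>
    intro hj
    have ha := ih (by omega)
    have hb : p ^ j ∣ b := (dvd_iff_dvd_of_dvd_sub ((pow_dvd_pow p (by omega)).trans hab)).1 ha
    rcases succ_dvd_or_succ_dvd_of_succ_sum_dvd_mul hp ha hb
      ((pow_dvd_pow p (by omega)).trans h) with h' | h'
    · exact h'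
    · exact (dvd_iff_dvd_of_dvd_sub ((pow_dvd_pow p hj).trans hab)).2 h'

theorem solution_congruent_to_d_inv (ℓ : ℕ) (hℓ : ℓ.Prime) (γ : ℕ) (hγ : 1 ≤ γ)
    (q : ℤ) (hlq : ¬ (ℓ : ℤ) ∣ q) (d : ℤ) (hd : Int.gcd d ℓ = 1)
    (hdq : (ℓ : ℤ) ^ γ ∣ d ^ 2 * q - 1)
    (t : ℤ) (ht : (ℓ : ℤ) ^ (2 * γ) ∣ d ^ 2 * q + 1 - d * t)
    (i : ℕ) (hi : 2 * γ ≤ i) (c : ℤ) (hc : (ℓ : ℤ) ^ i ∣ c ^ 2 - t * c + q) :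
    (ℓ : ℤ) ^ γ ∣ d * c - 1 := by
  apply (Nat.prime_iff_prime_int.mp hℓ).pow_dvd_of_pow_two_mul_dvd_mul (b := d * c - d ^ 2 * q)
  · rwa [show d * c - 1 - (d * c - d ^ 2 * q) = d ^ 2 * q - 1 by ring]
  · rw [show (d * c - 1) * (d * c - d ^ 2 * q) =
      d ^ 2 * (c ^ 2 - t * c + q) - d * c * (d ^ 2 * q + 1 - d * t) by ring]
    exact dvd_sub (((pow_dvd_pow _ hi).trans hc).mul_left _) (ht.mul_left _)
end

section
/- Let ℓ be a prime, q a positive integer with ℓ ∤ q, and d an integer with gcd(d, ℓ) = 1. Let α ≤ β < γ be natural numbers with ℓ^β = gcd(d²q − 1, ℓ^γ). Let t be an integer with t² ≠ 4q, let ν = v_ℓ(t² − 4q), let κ be a natural number with 2κ ≤ ν, and set k = min(κ, α + γ). Let W be the number of units c of ℤ/ℓ^{α+γ}ℤ such that the image of c in ℤ/ℓ^γℤ satisfies d·c = 1 and such that some integer C with C ≡ c (mod ℓ^{α+γ}) satisfies ℓ^{α+γ+k} ∣ C² − t·C + q. Then: (1) if k ≤ β − α, then W = ℓ^α if ℓ^{α+γ+k}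 ∣ d²q + 1 − d·t, and W = 0 otherwise; (2) if β − α ≤ k, then ℓ^k·W = ℓ^β if ℓ^{β+γ} ∣ d²q + 1 − d·t, and W = 0 otherwise. -/
theorem ZMod.card_unitsMap_fiber_prime_pow {p n N : ℕ} (hp : p.Prime) (hn : 0 < n)
    (hnN : n ≤ N) (u : (ZMod (p ^ n))ˣ) :
    Nat.card {c : (ZMod (p ^ N))ˣ // ZMod.unitsMap (pow_dvd_pow p hnN) c = u} = p ^ (N - n) := by
  have : NeZero (p ^ n) := ⟨pow_ne_zero _ hp.ne_zero⟩
  have : NeZero (p ^ N) := ⟨pow_ne_zero _ hp.ne_zero⟩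
  set f := ZMod.unitsMap (pow_dvd_pow p hnN)
  have hf : Function.Surjective f := ZMod.unitsMap_surjective _
  have hfib : Nat.card {c // f c = u} = Nat.card f.ker := by
    obtain ⟨c₀, rfl⟩ := hf u
    exact Nat.card_congr ((Equiv.mulLeft c₀⁻¹).subtypeEquiv fun c => by
      rw [MonoidHom.mem_ker, Equiv.coe_mulLeft, map_mul, map_inv, inv_mul_eq_one, eq_comm])
  have hcard := f.ker.card_mul_index
  rw [Subgroup.index_ker, MonoidHom.range_eq_top.mpr hf, Subgroup.card_top,
    Nat.card_eq_fintype_card (α := (ZMod (p ^ n))ˣ), Nat.card_eq_fintype_card (α := (ZMod (p ^ N))ˣ),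
    ZMod.card_units_eq_totient, ZMod.card_units_eq_totient, Nat.totient_prime_pow hp hn,
    Nat.totient_prime_pow hp (hn.trans_le hnN)] at hcard
  have hpos : 0 < p ^ (n - 1) * (p - 1) :=
    mul_pos (pow_pos hp.pos _) (Nat.sub_pos_of_lt hp.one_lt)
  rw [hfib]
  refine Nat.eq_of_mul_eq_mul_right hpos (hcard.trans ?_)
  rw [← mul_assoc, ← pow_add]
  congr 2
  omega

theorem ZMod.card_units_lift_modEq_prime_pow {p n N : ℕ} (hp : p.Prime) (hn : 0 < n)
    (hnN : n ≤ N) {a : ℤ} (ha : ¬ (p : ℤ) ∣ a) :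
    Nat.card {c : (ZMod (p ^ N))ˣ // ∃ C : ℤ, (C : ZMod (p ^ N)) = c ∧ (p : ℤ) ^ n ∣ C - a} =
      p ^ (N - n) := by
  have hcop : IsCoprime a ((p ^ n : ℕ) : ℤ) := by
    push_cast
    exact ((Nat.prime_iff_prime_int.mp hp).coprime_iff_not_dvd.mpr ha).symm.pow_right
  rw [← ZMod.card_unitsMap_fiber_prime_pow hp hn hnN (ZMod.unitOfIsCoprime a hcop)]
  refine Nat.card_congr (Equiv.subtypeEquivRight fun c => ?_)
  have hiff (C : ℤ) (hC : (C : ZMod (p ^ N)) = c) :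
      ZMod.unitsMap (pow_dvd_pow p hnN) c = ZMod.unitOfIsCoprime a hcop ↔
        (p : ℤ) ^ n ∣ C - a := by
    rw [Units.ext_iff, ZMod.unitsMap_val, ← hC, ZMod.coe_unitOfIsCoprime,
      ZMod.cast_intCast (pow_dvd_pow p hnN), eq_comm, ZMod.intCast_eq_intCast_iff_dvd_sub]
    push_cast
    rfl
  constructor
  · rintro ⟨C, hC, h⟩
    exact (hiff C hC).mpr h
  · intro h
    obtain ⟨C, hC⟩ := ZMod.intCast_surjective (c : ZMod (p ^ N))
    exact ⟨C, hC, (hiff C hC).mp h⟩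

section HeckePolynomial

variable {p d q t : ℤ} {β γ : ℕ}

theorem not_dvd_of_pow_dvd_mul_sub_one (hp : Prime p) (hγ : 0 < γ) {C : ℤ}
    (hC : p ^ γ ∣ d * C - 1) : ¬ p ∣ C := fun h =>
  hp.not_dvd_one <| by
    simpa using dvd_sub (h.mul_left d) ((dvd_pow_self p hγ.ne').trans hC)

theorem pow_dvd_hecke_iff_of_le (hp : Prime p) (hd : ¬ p ∣ d) (hγ : 0 < γ)
    (hD : p ^ β ∣ d ^ 2 * q - 1) (hβγ : β ≤ γ) {n : ℕ} (hn : n ≤ β + γ) {C : ℤ}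
    (hC : p ^ γ ∣ d * C - 1) :
    p ^ n ∣ C ^ 2 - t * C + q ↔ p ^ n ∣ d ^ 2 * q + 1 - d * t := by
  have hcd : IsCoprime (p ^ n) d := (hp.coprime_iff_not_dvd.mpr hd).pow_left
  have hcC : IsCoprime (p ^ n) C :=
    (hp.coprime_iff_not_dvd.mpr (not_dvd_of_pow_dvd_mul_sub_one hp hγ hC)).pow_left
  have herr : p ^ n ∣ (d * C - 1) * (d * C - 1 - (d ^ 2 * q - 1)) := by
    refine (pow_dvd_pow p hn).trans ?_
    rw [add_comm, pow_add]
    exact mul_dvd_mul hC (dvd_sub ((pow_dvd_pow p hβγ).trans hC) hD)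
  have hid : d ^ 2 * (C ^ 2 - t * C + q) = d * C * (d ^ 2 * q + 1 - d * t) +
      (d * C - 1) * (d * C - 1 - (d ^ 2 * q - 1)) := by ring
  constructor
  · intro h
    have h1 := h.mul_left (d ^ 2)
    rw [hid, dvd_add_left herr] at h1
    exact (hcd.mul_right hcC).dvd_of_dvd_mul_left h1
  · intro h
    refine (hcd.pow_right (n := 2)).dvd_of_dvd_mul_left ?_
    rw [hid]
    exact dvd_add (h.mul_left _) herr

theorem exists_add_sub_trace_eq (hp : Prime p) (hd : ¬ p ∣ d) (hβγ : β < γ) {v : ℤ}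
    (hv : ¬ p ∣ v) (htd : 2 - d * t = p ^ β * v) {C C' : ℤ} (hC : p ^ γ ∣ d * C - 1)
    (hC' : p ^ γ ∣ d * C' - 1) : ∃ w, ¬ p ∣ w ∧ C + C' - t = p ^ β * w := by
  obtain ⟨y, hy⟩ := (pow_dvd_pow p (Nat.succ_le_of_lt hβγ)).trans (dvd_add hC hC')
  have hid : d * (C + C' - t) = p ^ β * (p * y + v) := by
    rw [pow_succ] at hy
    linear_combination hy + htd
  obtain ⟨w, hw⟩ := ((hp.coprime_iff_not_dvd.mpr hd).pow_left (m := β)).dvd_of_dvd_mul_left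
    (Dvd.intro _ hid.symm)
  refine ⟨w, fun h => hv ?_, hw⟩
  have h1 : d * w = p * y + v := by
    refine mul_left_cancel₀ (pow_ne_zero β hp.ne_zero) ?_
    linear_combination hid - d * hw
  rw [← dvd_add_right (Dvd.intro y rfl : p ∣ p * y), ← h1]
  exact h.mul_left d

theorem exists_pow_dvd_hecke (hp : Prime p) (hd : ¬ p ∣ d) (hβγ : β < γ)
    (hD : p ^ β ∣ d ^ 2 * q - 1) {v : ℤ} (hv : ¬ p ∣ v) (htd : 2 - d * t = p ^ β * v)
    (hA : p ^ (β + γ) ∣ d ^ 2 * q + 1 - d * t) (m : ℕ) :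
    ∃ C : ℤ, p ^ γ ∣ d * C - 1 ∧ p ^ (β + γ + m) ∣ C ^ 2 - t * C + q := by
  induction m with
  | zero =>
    obtain ⟨a, b, hab⟩ := (hp.coprime_iff_not_dvd.mpr hd).pow_left (m := γ)
    have hb : p ^ γ ∣ d * b - 1 := ⟨-a, by linear_combination hab⟩
    exact ⟨b, hb, (pow_dvd_hecke_iff_of_le hp hd (by omega) hD hβγ.le le_rfl hb).mpr hA⟩
  | succ m ih =>
    obtain ⟨C, hC, b, hb⟩ := ih
    obtain ⟨w, hw, hCw⟩ := exists_add_sub_trace_eq hp hd hβγ hv htd hC hC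
    obtain ⟨x, y, hxy⟩ := hp.coprime_iff_not_dvd.mpr hw
    obtain ⟨e, rfl⟩ := Nat.exists_eq_add_of_lt hβγ
    refine ⟨C + p ^ (β + e + 1 + m) * (-b * y), ?_, b * x + p ^ (e + m) * (b * y) ^ 2, ?_⟩
    · have : d * (C + p ^ (β + e + 1 + m) * (-b * y)) - 1 =
          (d * C - 1) + p ^ (β + e + 1) * (p ^ m * (d * (-b * y))) := by ring
      rw [this]
      exact dvd_add hC (Dvd.intro _ rfl)
    · linear_combination hb - p ^ (β + e + 1 + m) * b * y * hCw
        + p ^ (β + (β + e + 1) + m) * b * (-hxy)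

theorem pow_dvd_hecke_iff_dvd_sub (hp : Prime p) (hd : ¬ p ∣ d) (hβγ : β < γ) {v : ℤ}
    (hv : ¬ p ∣ v) (htd : 2 - d * t = p ^ β * v) {m : ℕ} {C₀ : ℤ} (hC₀ : p ^ γ ∣ d * C₀ - 1)
    (hE₀ : p ^ (β + γ + m) ∣ C₀ ^ 2 - t * C₀ + q) (C : ℤ) :
    (p ^ γ ∣ d * C - 1 ∧ p ^ (β + γ + m) ∣ C ^ 2 - t * C + q) ↔ p ^ (γ + m) ∣ C - C₀ := by
  have hγ : p ^ (γ + m) ∣ C - C₀ → p ^ γ ∣ d * C - 1 := fun h => by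
    rw [show d * C - 1 = d * (C - C₀) + (d * C₀ - 1) by ring]
    exact dvd_add (((pow_dvd_pow p (γ.le_add_right m)).trans h).mul_left d) hC₀
  rw [← and_iff_right_of_imp hγ]
  refine and_congr_right fun hC => ?_
  obtain ⟨w, hw, hCw⟩ := exists_add_sub_trace_eq hp hd hβγ hv htd hC hC₀
  have hid : C ^ 2 - t * C + q = p ^ β * ((C - C₀) * w) + (C₀ ^ 2 - t * C₀ + q) := by
    linear_combination (C - C₀) * hCw
  rw [hid, dvd_add_left hE₀, add_assoc, pow_add,
    mul_dvd_mul_iff_left (pow_ne_zero β hp.ne_zero)]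
  exact ⟨((hp.coprime_iff_not_dvd.mpr hw).pow_left).dvd_of_dvd_mul_right,
    fun h => h.mul_right w⟩

theorem le_of_pow_dvd_discr (hp : Prime p) (hβγ : β < γ) {v : ℤ}
    (hv : ¬ p ∣ v) (htd : 2 - d * t = p ^ β * v) (hA : p ^ (β + γ) ∣ d ^ 2 * q + 1 - d * t)
    {κ : ℕ} (hκ : p ^ (2 * κ) ∣ t ^ 2 - 4 * q) : κ ≤ β := by
  by_contra! hlt
  have h1 : p ^ (2 * β + 1) ∣ (p ^ β * v) ^ 2 := by
    rw [← htd, show (2 - d * t) ^ 2 = d ^ 2 * (t ^ 2 - 4 * q) + 4 * (d ^ 2 * q + 1 - d * t) by ring]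
    exact dvd_add (((pow_dvd_pow p (by omega)).trans hκ).mul_left _)
      (((pow_dvd_pow p (by omega)).trans hA).mul_left _)
  rw [mul_pow, ← pow_mul, mul_comm β, pow_succ,
    mul_dvd_mul_iff_left (pow_ne_zero _ hp.ne_zero)] at h1
  exact hv (hp.dvd_of_dvd_pow h1)

end HeckePolynomial


theorem weight_count_eval_beta_lt_gamma (ℓ : ℕ) (hℓ : ℓ.Prime) (q : ℤ) (hqpos : 0 < q)
    (hlq : ¬ (ℓ : ℤ) ∣ q) (d : ℤ) (hd : Int.gcd d ℓ = 1)
    (α β γ : ℕ) (hαβ : α ≤ β) (hβγ : β < γ)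
    (hβ : ℓ ^ β = Int.gcd (d ^ 2 * q - 1) ((ℓ : ℤ) ^ γ))
    (t : ℤ) (ht : t ^ 2 ≠ 4 * q)
    (ν : ℕ) (hν : ν = padicValInt ℓ (t ^ 2 - 4 * q))
    (κ : ℕ) (hκ : 2 * κ ≤ ν)
    (k : ℕ) (hk : k = min κ (α + γ))
    (W : ℕ)
    (hW : W = Nat.card {c : (ZMod (ℓ ^ (α + γ)))ˣ //
      ∃ C : ℤ, (C : ZMod (ℓ ^ (α + γ))) = (c : ZMod (ℓ ^ (α + γ))) ∧
        (ℓ : ℤ) ^ γ ∣ d * C - 1 ∧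
        (ℓ : ℤ) ^ (α + γ + k) ∣ C ^ 2 - t * C + q}) :
    (k ≤ β - α →
      W = if (ℓ : ℤ) ^ (α + γ + k) ∣ d ^ 2 * q + 1 - d * t then ℓ ^ α else 0) ∧
    (β - α ≤ k →
      ((ℓ : ℤ) ^ (β + γ) ∣ d ^ 2 * q + 1 - d * t → ℓ ^ k * W = ℓ ^ β) ∧
      (¬ (ℓ : ℤ) ^ (β + γ) ∣ d ^ 2 * q + 1 - d * t → W = 0)) := by
  have hp : Prime (ℓ : ℤ) := Nat.prime_iff_prime_int.mp hℓ
  have hγ : 0 < γ := by omega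
  have hld : ¬ (ℓ : ℤ) ∣ d :=
    hp.coprime_iff_not_dvd.mp (Int.isCoprime_iff_gcd_eq_one.mpr hd).symm
  have hβ' : (ℓ : ℤ) ^ β = Int.gcd (d ^ 2 * q - 1) ((ℓ : ℤ) ^ γ) := by exact_mod_cast hβ
  have hD : (ℓ : ℤ) ^ β ∣ d ^ 2 * q - 1 := hβ' ▸ Int.gcd_dvd_left _ _
  have hD' : ¬ (ℓ : ℤ) ^ (β + 1) ∣ d ^ 2 * q - 1 := fun h => by
    have h1 := Int.dvd_coe_gcd h (pow_dvd_pow (ℓ : ℤ) (Nat.succ_le_of_lt hβγ))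
    rw [← hβ', pow_dvd_pow_iff hp.ne_zero hp.not_isUnit] at h1
    omega
  subst hW
  constructor
  · intro hkβ
    have hiff {C : ℤ} (hC : (ℓ : ℤ) ^ γ ∣ d * C - 1) :=
      pow_dvd_hecke_iff_of_le (t := t) hp hld hγ hD hβγ.le
        (n := α + γ + k) (by omega) hC
    split_ifs with hA
    · obtain ⟨a, b, hab⟩ := (hp.coprime_iff_not_dvd.mpr hld).pow_left (m := γ)
      have hb : (ℓ : ℤ) ^ γ ∣ d * b - 1 := ⟨-a, by linear_combination hab⟩
      have hcard := ZMod.card_units_lift_modEq_prime_pow hℓ hγ (Nat.le_add_left γ α)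
        (not_dvd_of_pow_dvd_mul_sub_one hp hγ hb)
      rw [Nat.add_sub_cancel] at hcard
      rw [← hcard]
      refine Nat.card_congr (Equiv.subtypeEquivRight fun c =>
        exists_congr fun C => and_congr_right fun _ => ?_)
      rw [and_iff_left_of_imp fun hC => (hiff hC).mpr hA,
        show d * C - 1 = d * (C - b) + (d * b - 1) by ring, dvd_add_left hb]
      exact ⟨((hp.coprime_iff_not_dvd.mpr hld).pow_left).dvd_of_dvd_mul_left,
        fun h => h.mul_left d⟩
    · rw [Nat.card_eq_zero]
      exact Or.inl ⟨fun ⟨_, _, _, hC, hE⟩ => hA ((hiff hC).mp hE)⟩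
  · intro hkβ
    refine ⟨fun hA => ?_, fun hA => ?_⟩
    · obtain ⟨v, hv⟩ : (ℓ : ℤ) ^ β ∣ 2 - d * t := by
        rw [show 2 - d * t = (d ^ 2 * q + 1 - d * t) - (d ^ 2 * q - 1) by ring]
        exact dvd_sub ((pow_dvd_pow _ (by omega)).trans hA) hD
      have hlv : ¬ (ℓ : ℤ) ∣ v := fun h => hD' <| by
        rw [show d ^ 2 * q - 1 = (d ^ 2 * q + 1 - d * t) - (2 - d * t) by ring, hv, pow_succ]
        refine dvd_sub ?_ (mul_dvd_mul_left _ h)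
        rw [← pow_succ]
        exact (pow_dvd_pow _ (by omega)).trans hA
      have hκβ : κ ≤ β := by
        refine le_of_pow_dvd_discr hp hβγ hlv hv hA ((pow_dvd_pow _ hκ).trans ?_)
        rw [hν]
        exact padicValInt_dvd _
      obtain ⟨m, hm⟩ : ∃ m, α + k = β + m := Nat.exists_eq_add_of_le (by omega)
      obtain ⟨C₀, hC₀, hE₀⟩ := exists_pow_dvd_hecke hp hld hβγ hD hlv hv hA m
      have hcard := ZMod.card_units_lift_modEq_prime_pow hℓ (n := γ + m) (N := α + γ)
        (by omega) (by omega) (not_dvd_of_pow_dvd_mul_sub_one hp hγ hC₀)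
      rw [show α + γ + k = β + γ + m by omega]
      simp_rw [pow_dvd_hecke_iff_dvd_sub hp hld hβγ hlv hv hC₀ hE₀]
      rw [hcard, ← pow_add]
      congr 1
      omega
    · rw [Nat.card_eq_zero]
      exact Or.inl ⟨fun ⟨_, _, _, hC, hE⟩ => hA
        ((pow_dvd_hecke_iff_of_le hp hld hγ hD hβγ.le le_rfl hC).mp
          ((pow_dvd_pow _ (by omega)).trans hE))⟩
end

section
/- Let ℓ be a prime, q a positive integer with ℓ ∤ q, and d an integer with gcd(d, ℓ) = 1. Let α ≤ γ be natural numbers with ℓ^γ ∣ d²q − 1 (the case β = γ). Let t be an integer with t² ≠ 4q, let ν = v_ℓ(t² − 4q), let κ be a natural number with 2κ ≤ ν, and set k = min(κ, α + γ). Let W be the number of units c of ℤ/ℓ^{α+γ}ℤ such that the image of c in ℤ/ℓ^γℤ satisfies d·c = 1 and such that some integer C with C ≡ c (mod ℓ^{α+γ}) satisfies ℓ^{α+γ+k} ∣ C² − t·C + q. Then: (1) if k ≤ γ − α, then W = ℓ^α if ℓ^{α+γ+k} ∣ d²q + 1 − d·t, and W = 0 otherwise; (2) if γ − α ≤ k,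 then ℓ^k·W = S(Δ*, ℓ^{α+γ+k}) if ℓ^{2γ} ∣ d²q + 1 − d·t, and W = 0 otherwise, where Δ* = t² − 4q if ℓ is odd and Δ* = (t² − 4q)/4 if ℓ = 2 (interpreted via integer division; whenever γ ≥ 1 and the divisibility ℓ^{2γ} ∣ d²q + 1 − dt holds, t is even and the division is exact), and S(a, n) denotes the number of x ∈ ℤ/nℤ with x² = a. -/
/-- `Scount a n` is the number of solutions of `x² ≡ a (mod n)`. -/
noncomputable def Scount (a : ℤ) (n : ℕ) : ℕ :=
  Nat.card {x : ZMod n // x ^ 2 = (a : ZMod n)}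

/-- Preimages under a surjective homomorphism of additive groups are `#ker` times as large. -/
theorem AddMonoidHom.natCard_preimage_of_surjective {G H : Type*} [AddGroup G] [AddGroup H]
    (f : G →+ H) (hf : Function.Surjective f) (S : Set H) :
    Nat.card (f ⁻¹' S) = Nat.card f.ker * Nat.card S := by
  let e := QuotientAddGroup.quotientKerEquivOfSurjective f hf
  have h : Nat.card (e ⁻¹' S) = Nat.card S :=
    Nat.card_preimage_of_injective e.injective fun x _ => e.surjective x
  rw [← h, ← Nat.card_prod]
  exact Nat.card_congr (QuotientAddGroup.preimageMkEquivAddSubgroupProdSet f.ker (e ⁻¹' S))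

theorem ZMod.natCard_castHom_preimage_mul {a m : ℕ} (h : a ∣ m) (S : Set (ZMod a)) :
    Nat.card (ZMod.castHom h (ZMod a) ⁻¹' S) * a = m * Nat.card S := by
  have key := AddMonoidHom.natCard_preimage_of_surjective
    (ZMod.castHom h (ZMod a)).toAddMonoidHom (ZMod.castHom_surjective h)
  have hS := key S
  have hU := key Set.univ
  rw [Set.preimage_univ, Nat.card_univ, Nat.card_univ, Nat.card_zmod, Nat.card_zmod] at hU
  calc Nat.card (ZMod.castHom h (ZMod a) ⁻¹' S) * a
      = Nat.card (ZMod.castHom h (ZMod a)).toAddMonoidHom.ker * Nat.card S * a :=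
        congrArg (· * a) hS
    _ = m * Nat.card S := by rw [mul_right_comm, ← hU]

theorem Prime.pow_dvd_of_pow_two_mul_dvd_mul_sub {p z e : ℤ} (hp : Prime p) {g : ℕ}
    (he : p ^ g ∣ e) (h : p ^ (2 * g) ∣ z * (z - e)) : p ^ g ∣ z := by
  suffices ∀ j ≤ g, p ^ j ∣ z from this g le_rfl
  intro j
  induction j with
  | zero => simp
  | succ j ih =>
    intro hj
    obtain ⟨w, rfl⟩ := ih (by lia)
    obtain ⟨e', rfl⟩ := (pow_dvd_pow p hj).trans he
    have h2 : p ^ (2 * j) * p ∣ p ^ (2 * j) * (w * (w - p * e')) := by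
      refine ((pow_succ p (2 * j)).symm.dvd.trans (pow_dvd_pow p (by lia))).trans (h.trans ?_)
      exact Eq.dvd (by ring)
    have h3 := (mul_dvd_mul_iff_left (pow_ne_zero _ hp.ne_zero)).1 h2
    have h4 : p ∣ w := by
      rcases hp.dvd_or_dvd h3 with h4 | h4
      · exact h4
      · exact (dvd_sub_left (dvd_mul_right p e')).1 h4
    rw [pow_succ]
    exact mul_dvd_mul_left _ h4

section Hecke

variable {p q d t C : ℤ} {γ m : ℕ}

/-- Multiplied by `d²`, the Hecke polynomial at `C` factors up to a multiple of
`d²q + 1 - dt`. -/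
theorem sq_mul_hecke (q d t C : ℤ) :
    d ^ 2 * (C ^ 2 - t * C + q) =
      (d * C - 1) * (d * C - 1 - (d ^ 2 * q - 1)) + (d ^ 2 * q + 1 - d * t) * (d * C) := by
  ring

theorem pow_dvd_hecke_iff (hpd : IsCoprime p d) (hγ0 : 0 < γ) (hγ : p ^ γ ∣ d ^ 2 * q - 1)
    (hC : p ^ γ ∣ d * C - 1) (hm : m ≤ 2 * γ) :
    p ^ m ∣ C ^ 2 - t * C + q ↔ p ^ m ∣ d ^ 2 * q + 1 - d * t := by
  have hdC : IsCoprime p (d * C) := by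
    obtain ⟨w, hw⟩ := (dvd_pow_self p hγ0.ne').trans hC
    exact ⟨-w, 1, by linarith⟩
  have hz : p ^ m ∣ (d * C - 1) * (d * C - 1 - (d ^ 2 * q - 1)) :=
    (pow_dvd_pow p hm).trans (by
      rw [two_mul, pow_add]
      exact mul_dvd_mul hC (dvd_sub hC hγ))
  have h1 : IsCoprime (p ^ m) (d ^ 2) := hpd.pow
  have h2 : IsCoprime (p ^ m) (d * C) := hdC.pow_left
  have h3 : p ^ m ∣ d ^ 2 * (C ^ 2 - t * C + q) ↔ p ^ m ∣ d ^ 2 * q + 1 - d * t := by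
    rw [sq_mul_hecke, dvd_add_right hz]
    exact ⟨h2.dvd_of_dvd_mul_right, fun h => h.mul_right _⟩
  exact ⟨fun h => h3.1 (h.mul_left _), fun h => h1.dvd_of_dvd_mul_left (h3.2 h)⟩

theorem pow_dvd_sub_one_of_hecke (hp : Prime p) (hγ : p ^ γ ∣ d ^ 2 * q - 1)
    (hA : p ^ (2 * γ) ∣ d ^ 2 * q + 1 - d * t) (hC : p ^ (2 * γ) ∣ C ^ 2 - t * C + q) :
    p ^ γ ∣ d * C - 1 := by
  refine hp.pow_dvd_of_pow_two_mul_dvd_mul_sub hγ ?_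
  have h := hC.mul_left (d ^ 2)
  rw [sq_mul_hecke] at h
  exact (dvd_add_left (hA.mul_right _)).1 h

/-- The roots of the Hecke polynomial modulo `p ^ (n + k)` are stable under translation by
multiples of `p ^ n`. -/
theorem pow_dvd_hecke_of_pow_dvd_sub {n k : ℕ} {X : ℤ} (hk : k ≤ n)
    (hD : p ^ (2 * k) ∣ t ^ 2 - 4 * q) (hXC : p ^ n ∣ X - C)
    (hC : p ^ (n + k) ∣ C ^ 2 - t * C + q) : p ^ (n + k) ∣ X ^ 2 - t * X + q := by
  have hsq : (p ^ k) ^ 2 ∣ (2 * C - t) ^ 2 := by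
    have h : (2 * C - t) ^ 2 = 4 * (C ^ 2 - t * C + q) + (t ^ 2 - 4 * q) := by ring
    rw [h, ← pow_mul, mul_comm k 2]
    exact dvd_add (((pow_dvd_pow p (by lia)).trans hC).mul_left 4) hD
  have hlin : p ^ k ∣ 2 * C - t := (Int.pow_dvd_pow_iff two_ne_zero).1 hsq
  have h : X ^ 2 - t * X + q =
      (C ^ 2 - t * C + q) + (X - C) * ((2 * C - t) + (X - C)) := by ring
  rw [h, pow_add]
  refine dvd_add (pow_add p n k ▸ hC) (mul_dvd_mul hXC (dvd_add hlin ?_))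
  exact (pow_dvd_pow p hk).trans hXC

end Hecke

/-- Solutions of `x² ≡ a` modulo `n` correspond to roots of the Hecke polynomial when the
polynomial can be completed to the square `(u x - s)² - a` with `u` invertible. -/
theorem Scount_eq_natCard_roots {n : ℕ} {a q t u s v : ℤ} (huv : ((u * v : ℤ) : ZMod n) = 1)
    (h : ∀ x : ZMod n, (u * x - s) ^ 2 - a = u ^ 2 * (x ^ 2 - t * x + q)) :
    Scount a n = Nat.card {x : ZMod n | x ^ 2 - t * x + q = 0} := by
  push_cast at huv
  let e : ZMod n ≃ ZMod n :=
    { toFun := fun x => u * x - s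
      invFun := fun y => v * (y + s)
      left_inv := fun x => by linear_combination x * huv
      right_inv := fun y => by linear_combination (y + s) * huv }
  refine (Nat.card_congr (e.subtypeEquiv fun x => ?_)).symm
  change x ^ 2 - t * x + q = 0 ↔ (u * x - s) ^ 2 = (a : ZMod n)
  rw [← sub_eq_zero (b := (a : ZMod n)), h x]
  constructor
  · intro hx
    rw [hx, mul_zero]
  · intro hx
    linear_combination v ^ 2 * hx - (u * v + 1) * (x ^ 2 - t * x + q) * huv

theorem Scount_discr_eq_natCard_roots {ℓ : ℕ} (hℓ : ℓ.Prime) {q t : ℤ} (N : ℕ)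
    (ht : ℓ = 2 → N ≠ 0 → Even t) :
    Scount (if ℓ = 2 then (t ^ 2 - 4 * q) / 4 else t ^ 2 - 4 * q) (ℓ ^ N) =
      Nat.card {x : ZMod (ℓ ^ N) | x ^ 2 - t * x + q = 0} := by
  rcases eq_or_ne N 0 with rfl | hN
  · have hs : Subsingleton (ZMod (ℓ ^ 0)) := by
      rw [pow_zero]
      infer_instance
    exact Scount_eq_natCard_roots (u := 1) (v := 1) (s := 0) (Subsingleton.elim _ _)
      fun x => Subsingleton.elim _ _
  split_ifs with h2
  · obtain ⟨s, rfl⟩ := ht h2 hN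
    have hdiv : ((s + s) ^ 2 - 4 * q) / 4 = s ^ 2 - q := by
      rw [show (s + s) ^ 2 - 4 * q = 4 * (s ^ 2 - q) by ring]
      exact Int.mul_ediv_cancel_left _ (by norm_num)
    rw [hdiv]
    refine Scount_eq_natCard_roots (u := 1) (v := 1) (s := s) (by norm_num) fun x => ?_
    push_cast
    ring
  · have hc : IsCoprime ((ℓ ^ N : ℕ) : ℤ) 2 := by
      have := (Nat.coprime_primes hℓ Nat.prime_two).2 h2
      exact_mod_cast Nat.isCoprime_iff_coprime.2 (this.pow_left N)
    obtain ⟨a, b, hab⟩ := hc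
    refine Scount_eq_natCard_roots (u := 2) (v := b) (s := t) ?_ fun x => ?_
    · rw [mul_comm, ← sub_eq_zero, ← Int.cast_one, ← Int.cast_sub,
        ZMod.intCast_zmod_eq_zero_iff_dvd]
      exact ⟨-a, by linarith⟩
    · push_cast
      ring

/-- Residues modulo `p ^ n` inverse to `d` modulo `p ^ g` that lift to roots of the Hecke
polynomial modulo `p ^ m`. -/
def heckeResidues (p : ℕ) (q d t : ℤ) (n g m : ℕ) : Set (ZMod (p ^ n)) :=
  {c | ∃ C : ℤ, (C : ZMod (p ^ n)) = c ∧ (p : ℤ) ^ g ∣ d * C - 1 ∧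
    (p : ℤ) ^ m ∣ C ^ 2 - t * C + q}

theorem intCast_eq_intCast_zmod_pow_iff {p n : ℕ} {a b : ℤ} :
    (a : ZMod (p ^ n)) = b ↔ (p : ℤ) ^ n ∣ a - b := by
  rw [← sub_eq_zero, ← Int.cast_sub, ZMod.intCast_zmod_eq_zero_iff_dvd, Nat.cast_pow]

theorem natCard_units_heckeResidues {p : ℕ} {q d t : ℤ} {n g m : ℕ} (h : g = 0 → n = 0) :
    Nat.card {c : (ZMod (p ^ n))ˣ // (c : ZMod (p ^ n)) ∈ heckeResidues p q d t n g m} =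
      Nat.card (heckeResidues p q d t n g m) := by
  refine Nat.card_congr (Equiv.ofBijective (fun c => ⟨c.1, c.2⟩) ⟨fun a b hab => ?_, ?_⟩)
  · exact Subtype.ext (Units.ext (congrArg Subtype.val hab))
  · rintro ⟨c, hc⟩
    have hu : IsUnit c := by
      obtain ⟨C, rfl, hC, -⟩ := hc
      rw [ZMod.coe_int_isUnit_iff_isCoprime, Nat.cast_pow]
      rcases eq_or_ne g 0 with hg | hg
      · rw [h hg, pow_zero]
        exact isCoprime_one_left
      · obtain ⟨w, hw⟩ := (dvd_pow_self (p : ℤ) hg).trans hC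
        exact IsCoprime.pow_left ⟨-w, d, by linarith⟩
    exact ⟨⟨hu.unit, hc⟩, rfl⟩

/-- Up to level `2g` the Hecke condition does not depend on the residue. -/
theorem natCard_heckeResidues_of_le {p : ℕ} (hp : p.Prime) {q d t : ℤ} {a g m : ℕ}
    (hpd : IsCoprime (p : ℤ) d) (hag : a ≤ g) (hg : (p : ℤ) ^ g ∣ d ^ 2 * q - 1)
    (hm : m ≤ 2 * g) :
    Nat.card (heckeResidues p q d t (a + g) g m) =
      if (p : ℤ) ^ m ∣ d ^ 2 * q + 1 - d * t then p ^ a else 0 := by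
  have hiff : ∀ C : ℤ, (p : ℤ) ^ g ∣ d * C - 1 →
      ((p : ℤ) ^ m ∣ C ^ 2 - t * C + q ↔ (p : ℤ) ^ m ∣ d ^ 2 * q + 1 - d * t) := by
    intro C hC
    rcases Nat.eq_zero_or_pos g with rfl | hg0
    · obtain rfl : m = 0 := by lia
      simp
    · exact pow_dvd_hecke_iff hpd hg0 hg hC hm
  split_ifs with hA
  · have hdvd : p ^ g ∣ p ^ (a + g) := pow_dvd_pow p (by lia)
    obtain ⟨x, y, hxy⟩ : IsCoprime ((p : ℤ) ^ g) d := hpd.pow_left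
    have hset : heckeResidues p q d t (a + g) g m =
        ZMod.castHom hdvd (ZMod (p ^ g)) ⁻¹' {((y : ℤ) : ZMod (p ^ g))} := by
      ext c
      obtain ⟨X, rfl⟩ := ZMod.intCast_surjective c
      rw [Set.mem_preimage, map_intCast, Set.mem_singleton_iff, intCast_eq_intCast_zmod_pow_iff]
      constructor
      · rintro ⟨C, hCX, hC, -⟩
        rw [intCast_eq_intCast_zmod_pow_iff] at hCX
        obtain ⟨r, hr⟩ := (pow_dvd_pow (p : ℤ) (by lia : g ≤ a + g)).trans hCX
        obtain ⟨w, hw⟩ := hC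
        refine ⟨-r + x * C + y * w, ?_⟩
        linear_combination -hr + y * hw - C * hxy
      · rintro ⟨w, hw⟩
        have hX : (p : ℤ) ^ g ∣ d * X - 1 := ⟨d * w - x, by linear_combination d * hw + hxy⟩
        exact ⟨X, rfl, hX, (hiff X hX).2 hA⟩
    have hcard := ZMod.natCard_castHom_preimage_mul hdvd {((y : ℤ) : ZMod (p ^ g))}
    rw [hset]
    refine Nat.eq_of_mul_eq_mul_right (pow_pos hp.pos g) ?_
    rw [hcard, ← pow_add, Nat.card_unique, mul_one]
  · have : IsEmpty (heckeResidues p q d t (a + g) g m) :=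
      ⟨fun ⟨_, C, _, hC, hr⟩ => hA ((hiff C hC).1 hr)⟩
    exact Nat.card_of_isEmpty

theorem pow_mul_natCard_heckeResidues {p : ℕ} (hp : p.Prime) {q d t : ℤ} {n g k : ℕ}
    (hg : (p : ℤ) ^ g ∣ d ^ 2 * q - 1) (hA : (p : ℤ) ^ (2 * g) ∣ d ^ 2 * q + 1 - d * t)
    (hm : 2 * g ≤ n + k) (hk : k ≤ n) (hD : (p : ℤ) ^ (2 * k) ∣ t ^ 2 - 4 * q) :
    p ^ k * Nat.card (heckeResidues p q d t n g (n + k)) =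
      Nat.card {x : ZMod (p ^ (n + k)) | x ^ 2 - t * x + q = 0} := by
  have hdvd : p ^ n ∣ p ^ (n + k) := pow_dvd_pow p (by lia)
  have hset : {x : ZMod (p ^ (n + k)) | x ^ 2 - t * x + q = 0} =
      ZMod.castHom hdvd (ZMod (p ^ n)) ⁻¹' heckeResidues p q d t n g (n + k) := by
    ext c
    obtain ⟨X, rfl⟩ := ZMod.intCast_surjective c
    have hroot : ((X : ZMod (p ^ (n + k))) ^ 2 - t * X + q = 0) ↔
        (p : ℤ) ^ (n + k) ∣ X ^ 2 - t * X + q := by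
      rw [← Nat.cast_pow, ← ZMod.intCast_zmod_eq_zero_iff_dvd]
      push_cast
      rfl
    rw [Set.mem_preimage, map_intCast, Set.mem_ofPred_eq, hroot]
    constructor
    · intro hX
      exact ⟨X, rfl, pow_dvd_sub_one_of_hecke (Nat.prime_iff_prime_int.1 hp) hg hA
        ((pow_dvd_pow _ hm).trans hX), hX⟩
    · rintro ⟨C, hCX, -, hr⟩
      exact pow_dvd_hecke_of_pow_dvd_sub hk hD
        (intCast_eq_intCast_zmod_pow_iff.1 hCX.symm) hr
  have hcard := ZMod.natCard_castHom_preimage_mul hdvd (heckeResidues p q d t n g (n + k))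
  rw [hset]
  refine Nat.eq_of_mul_eq_mul_right (pow_pos hp.pos n) ?_
  rw [hcard, pow_add]
  ring

theorem weight_count_eval_beta_eq_gamma (ℓ : ℕ) (hℓ : ℓ.Prime) (q : ℤ) (hqpos : 0 < q)
    (hlq : ¬ (ℓ : ℤ) ∣ q) (d : ℤ) (hd : Int.gcd d ℓ = 1)
    (α γ : ℕ) (hαγ : α ≤ γ) (hγ : (ℓ : ℤ) ^ γ ∣ d ^ 2 * q - 1)
    (t : ℤ) (ht : t ^ 2 ≠ 4 * q)
    (ν : ℕ) (hν : ν = padicValInt ℓ (t ^ 2 - 4 * q))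
    (κ : ℕ) (hκ : 2 * κ ≤ ν)
    (k : ℕ) (hk : k = min κ (α + γ))
    (W : ℕ)
    (hW : W = Nat.card {c : (ZMod (ℓ ^ (α + γ)))ˣ //
      ∃ C : ℤ, (C : ZMod (ℓ ^ (α + γ))) = (c : ZMod (ℓ ^ (α + γ))) ∧
        (ℓ : ℤ) ^ γ ∣ d * C - 1 ∧
        (ℓ : ℤ) ^ (α + γ + k) ∣ C ^ 2 - t * C + q}) :
    (k ≤ γ - α →
      W = if (ℓ : ℤ) ^ (α + γ + k) ∣ d ^ 2 * q + 1 - d * t then ℓ ^ α else 0) ∧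
    (γ - α ≤ k →
      ((ℓ : ℤ) ^ (2 * γ) ∣ d ^ 2 * q + 1 - d * t →
        ℓ ^ k * W =
          Scount (if ℓ = 2 then (t ^ 2 - 4 * q) / 4 else t ^ 2 - 4 * q) (ℓ ^ (α + γ + k))) ∧
      (¬ (ℓ : ℤ) ^ (2 * γ) ∣ d ^ 2 * q + 1 - d * t → W = 0)) := by
  have hpd : IsCoprime (ℓ : ℤ) d := (Int.isCoprime_iff_gcd_eq_one.2 hd).symm
  have hWS : W = Nat.card (heckeResidues ℓ q d t (α + γ) γ (α + γ + k)) :=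
    hW.trans (natCard_units_heckeResidues (by lia))
  refine ⟨fun h => ?_, fun h => ⟨fun hA => ?_, fun hA => ?_⟩⟩
  · rw [hWS]
    exact natCard_heckeResidues_of_le hℓ hpd hαγ hγ (by lia)
  · have hD : (ℓ : ℤ) ^ (2 * k) ∣ t ^ 2 - 4 * q :=
      (pow_dvd_pow _ (by lia)).trans (hν ▸ padicValInt_dvd _)
    rw [hWS, pow_mul_natCard_heckeResidues hℓ hγ hA (by lia) (by lia) hD,
      Scount_discr_eq_natCard_roots hℓ]
    rintro rfl hN
    have hγ0 : γ ≠ 0 := by lia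
    have h1 : (2 : ℤ) ∣ d ^ 2 * q - 1 := (dvd_pow_self _ hγ0).trans hγ
    have h2 : (2 : ℤ) ∣ d ^ 2 * q + 1 - d * t :=
      (dvd_pow_self _ (mul_ne_zero two_ne_zero hγ0)).trans hA
    have h3 : (2 : ℤ) ∣ d * t := by lia
    exact even_iff_two_dvd.2 (IsCoprime.dvd_of_dvd_mul_left hpd h3)
  · have hle := natCard_heckeResidues_of_le hℓ (t := t) hpd hαγ hγ le_rfl
    rw [if_neg hA] at hle
    have hsub : heckeResidues ℓ q d t (α + γ) γ (α + γ + k) ⊆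
        heckeResidues ℓ q d t (α + γ) γ (2 * γ) := fun _ ⟨C, hc, hC, hr⟩ =>
      ⟨C, hc, hC, (pow_dvd_pow _ (by lia)).trans hr⟩
    have : NeZero (ℓ ^ (α + γ)) := ⟨pow_ne_zero _ hℓ.ne_zero⟩
    rw [hWS]
    exact Nat.le_zero.1 (hle ▸ Nat.card_mono (Set.toFinite _) hsub)
end

section
/- Let a be an integer, and for a positive integer n write S(a, n) for the number of elements x of ℤ/nℤ with x² equal to the reduction of a. Then S(a, 2) = 1; S(a, 4) = 2 if a ≡ 0 or 1 (mod 4) and S(a, 4) = 0 if a ≡ 2 or 3 (mod 4); and for every natural number ε ≥ 3: if a is odd then S(a, 2^ε) = 4 if a ≡ 1 (mod 8) and S(a, 2^ε) = 0 otherwise; if a ≡ 2 (mod 4) then S(a, 2^ε) = 0; and if 4 ∣ a then S(a, 2^ε) = 2 · S(a/4, 2^{ε−2}). -/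
theorem ZMod.intCast_sq_eq_iff (x a : ℤ) (n : ℕ) :
    (x : ZMod n) ^ 2 = (a : ZMod n) ↔ (n : ℤ) ∣ x ^ 2 - a := by
  rw [← Int.cast_pow, eq_comm, ZMod.intCast_eq_intCast_iff_dvd_sub]

theorem Scount_eq_of_mod_eq {a b : ℤ} {n : ℕ} (h : a % n = b % n) : Scount a n = Scount b n := by
  have hab : (a : ZMod n) = (b : ZMod n) := (ZMod.intCast_eq_intCast_iff' a b n).2 h
  rw [Scount, Scount, hab]

theorem Scount_eq_zero_of_dvd {a : ℤ} {m n : ℕ} (hmn : m ∣ n)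
    (h : ∀ x : ℤ, ¬ (m : ℤ) ∣ x ^ 2 - a) : Scount a n = 0 := by
  have : IsEmpty {x : ZMod n // x ^ 2 = (a : ZMod n)} := by
    refine ⟨fun ⟨x, hx⟩ => ?_⟩
    obtain ⟨y, rfl⟩ := ZMod.intCast_surjective x
    exact h y ((Int.natCast_dvd_natCast.2 hmn).trans ((ZMod.intCast_sq_eq_iff y a n).1 hx))
  exact Nat.card_of_isEmpty

theorem Scount_two (a : ℤ) : Scount a 2 = 1 := by
  rcases Int.emod_two_eq_zero_or_one a with h | h
  · rw [Scount_eq_of_mod_eq (b := 0) (by simpa using h), Scount, Nat.card_eq_fintype_card]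
    decide
  · rw [Scount_eq_of_mod_eq (b := 1) (by simpa using h), Scount, Nat.card_eq_fintype_card]
    decide

theorem Scount_four_eq_two {a : ℤ} (h : a % 4 = 0 ∨ a % 4 = 1) : Scount a 4 = 2 := by
  rcases h with h | h
  · rw [Scount_eq_of_mod_eq (b := 0) (by simpa using h), Scount, Nat.card_eq_fintype_card]
    decide
  · rw [Scount_eq_of_mod_eq (b := 1) (by simpa using h), Scount, Nat.card_eq_fintype_card]
    decide

theorem not_four_dvd_sq_sub {a : ℤ} (h : a % 4 = 2 ∨ a % 4 = 3) (x : ℤ) :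
    ¬ ((4 : ℕ) : ℤ) ∣ x ^ 2 - a := by
  rintro ⟨k, hk⟩
  push_cast at hk
  rcases Int.even_or_odd' x with ⟨m, rfl | rfl⟩ <;> ring_nf at hk <;> omega

theorem not_eight_dvd_sq_sub {a : ℤ} (ha : Odd a) (h : a % 8 ≠ 1) (x : ℤ) :
    ¬ ((8 : ℕ) : ℤ) ∣ x ^ 2 - a := by
  intro hk
  push_cast at hk
  rcases Int.even_or_odd x with hx | hx
  · obtain ⟨m, rfl⟩ := hx
    obtain ⟨k, hk⟩ := hk
    obtain ⟨b, rfl⟩ := ha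
    ring_nf at hk
    omega
  · have h8 : (8 : ℤ) ∣ x ^ 2 - 1 := Int.eight_dvd_sq_sub_one_of_odd hx
    omega

/-- A residue congruent to `1` modulo `8` is a square modulo every power of two. -/
theorem exists_two_pow_dvd_sq_sub {a : ℤ} (h : a % 8 = 1) (n : ℕ) :
    ∃ x : ℤ, Odd x ∧ (2 : ℤ) ^ (n + 3) ∣ x ^ 2 - a := by
  induction n with
  | zero => exact ⟨1, odd_one, by norm_num; omega⟩
  | succ n ih =>
    obtain ⟨x, ⟨m, rfl⟩, k, hk⟩ := ih
    rcases Int.even_or_odd' k with ⟨l, rfl | rfl⟩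
    · exact ⟨2 * m + 1, ⟨m, rfl⟩, l, by rw [hk]; ring⟩
    · refine ⟨2 * m + 1 + 2 ^ (n + 2), ⟨m + 2 ^ (n + 1), by ring⟩, l + m + 1 + 2 ^ n, ?_⟩
      linear_combination hk

/-- Two square roots of an odd residue modulo `4 * 2 ^ n` agree up to sign modulo `2 * 2 ^ n`. -/
theorem two_pow_dvd_sub_or_add {x y : ℤ} (hx : Odd x) {n : ℕ}
    (h : (2 : ℤ) ^ (n + 2) ∣ y ^ 2 - x ^ 2) :
    (2 : ℤ) ^ (n + 1) ∣ y - x ∨ (2 : ℤ) ^ (n + 1) ∣ y + x := by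
  have hy : Odd y := by
    have h2 : (2 : ℤ) ∣ y ^ 2 - x ^ 2 := (dvd_pow_self 2 (by omega)).trans h
    have : Even (y ^ 2 - x ^ 2) := even_iff_two_dvd.2 h2
    have hxy : Even y ↔ Even x := by simpa [Int.even_sub, Int.even_pow] using this
    rwa [← Int.not_even_iff_odd, hxy, Int.not_even_iff_odd]
  obtain ⟨u, hu⟩ : (2 : ℤ) ∣ y - x := (hy.sub_odd hx).two_dvd
  have hyx : y = x + 2 * u := by linarith
  subst hyx
  have huv : (2 : ℤ) ^ n ∣ u * (x + u) := by
    have h4 : (4 : ℤ) * 2 ^ n ∣ 4 * (u * (x + u)) := by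
      convert h using 1 <;> ring
    exact (mul_dvd_mul_iff_left (by norm_num)).1 h4
  have hcop {w : ℤ} (hw : Odd w) : IsCoprime ((2 : ℤ) ^ n) w :=
    IsCoprime.pow_left (Int.isCoprime_two_left.2 hw)
  rcases Int.even_or_odd u with he | ho
  · left
    have := (hcop (hx.add_even he)).dvd_of_dvd_mul_right huv
    rw [pow_succ, show x + 2 * u - x = u * 2 by ring]
    exact mul_dvd_mul_right this 2
  · right
    have := (hcop ho).dvd_of_dvd_mul_left huv
    rw [pow_succ, show x + 2 * u + x = (x + u) * 2 by ring]
    exact mul_dvd_mul_right this 2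

theorem Scount_two_pow_eq_four {a : ℤ} (h : a % 8 = 1) (n : ℕ) :
    Scount a (2 ^ (n + 3)) = 4 := by
  obtain ⟨x, hx, hxa⟩ := exists_two_pow_dvd_sq_sub h n
  have hset : {y : ZMod (2 ^ (n + 3)) | y ^ 2 = (a : ZMod (2 ^ (n + 3)))} =
      (({x, x + 2 ^ (n + 2), -x, -x + 2 ^ (n + 2)} : Finset ℤ).image
        (Int.cast : ℤ → ZMod (2 ^ (n + 3)))) := by
    ext y
    obtain ⟨y, rfl⟩ := ZMod.intCast_surjective y
    simp only [Set.mem_ofPred_eq, Finset.coe_image, Set.mem_image, Finset.mem_coe,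
      Finset.mem_insert, Finset.mem_singleton, ZMod.intCast_sq_eq_iff,
      ZMod.intCast_eq_intCast_iff_dvd_sub, exists_eq_or_imp, exists_eq_left]
    push_cast
    constructor
    · intro hy
      have hyx : (2 : ℤ) ^ (n + 1 + 2) ∣ y ^ 2 - x ^ 2 := by
        simpa using dvd_sub hy hxa
      rcases two_pow_dvd_sub_or_add hx hyx with ⟨k, hk⟩ | ⟨k, hk⟩ <;>
        rcases Int.even_or_odd' k with ⟨l, rfl | rfl⟩
      · exact Or.inl ⟨l, by linear_combination hk⟩
      · exact Or.inr (Or.inl ⟨l, by linear_combination hk⟩)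
      · exact Or.inr (Or.inr (Or.inl ⟨l, by linear_combination hk⟩))
      · exact Or.inr (Or.inr (Or.inr ⟨l, by linear_combination hk⟩))
    · obtain ⟨c, hc⟩ := hxa
      rintro (⟨k, hk⟩ | ⟨k, hk⟩ | ⟨k, hk⟩ | ⟨k, hk⟩)
      · obtain rfl : y = x + 2 ^ (n + 3) * k := by linarith
        exact ⟨c + 2 * x * k + 2 ^ (n + 3) * k ^ 2, by linear_combination hc⟩
      · obtain rfl : y = x + 2 ^ (n + 2) + 2 ^ (n + 3) * k := by linarith
        exact ⟨c + x * (1 + 2 * k) + 2 ^ (n + 1) * (1 + 2 * k) ^ 2, by linear_combination hc⟩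
      · obtain rfl : y = -x + 2 ^ (n + 3) * k := by linarith
        exact ⟨c - 2 * x * k + 2 ^ (n + 3) * k ^ 2, by linear_combination hc⟩
      · obtain rfl : y = -x + 2 ^ (n + 2) + 2 ^ (n + 3) * k := by linarith
        exact ⟨c - x * (1 + 2 * k) + 2 ^ (n + 1) * (1 + 2 * k) ^ 2, by linear_combination hc⟩
  have hodd (z w : ℤ) (hz : Odd z) : ¬ (2 : ℤ) ^ (n + 3) ∣ 2 * z + 4 * w := by
    rintro ⟨k, hk⟩
    obtain ⟨m, rfl⟩ := hz
    rw [pow_add] at hk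
    have : 2 * (2 * m + 1) + 4 * w = 8 * (2 ^ n * k) := by linear_combination hk
    omega
  have hhalf : ¬ (2 : ℤ) ^ (n + 3) ∣ 2 ^ (n + 2) := by
    rw [pow_dvd_pow_iff (by norm_num) (by decide)]
    omega
  have hcard : ((({x, x + 2 ^ (n + 2), -x, -x + 2 ^ (n + 2)} : Finset ℤ).image
      (Int.cast : ℤ → ZMod (2 ^ (n + 3))))).card = 4 := by
    have hne (z w : ℤ) (h : ¬ (2 : ℤ) ^ (n + 3) ∣ w - z) :
        (z : ZMod (2 ^ (n + 3))) ≠ (w : ZMod (2 ^ (n + 3))) := by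
      rw [Ne, ZMod.intCast_eq_intCast_iff_dvd_sub]
      exact_mod_cast h
    have h12 := hne x (x + 2 ^ (n + 2)) (by rwa [add_sub_cancel_left])
    have h13 := hne x (-x) (by convert hodd (-x) 0 hx.neg using 2; ring)
    have h14 := hne x (-x + 2 ^ (n + 2)) (by convert hodd (-x) (2 ^ n) hx.neg using 2; ring)
    have h23 := hne (x + 2 ^ (n + 2)) (-x) (by
      convert hodd (-x) (-2 ^ n) hx.neg using 2; ring)
    have h24 := hne (x + 2 ^ (n + 2)) (-x + 2 ^ (n + 2)) (by
      convert hodd (-x) 0 hx.neg using 2; ring)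
    have h34 := hne (-x) (-x + 2 ^ (n + 2)) (by rwa [add_sub_cancel_left])
    simp only [Finset.image_insert, Finset.image_singleton]
    rw [Finset.card_insert_of_notMem (by simp only [Finset.mem_insert, Finset.mem_singleton]; tauto),
      Finset.card_insert_of_notMem (by simp only [Finset.mem_insert, Finset.mem_singleton]; tauto),
      Finset.card_pair h34]
  change Nat.card {y : ZMod (2 ^ (n + 3)) | y ^ 2 = (a : ZMod (2 ^ (n + 3)))} = 4
  rw [hset, Nat.card_coe_set_eq, Set.ncard_coe_finset, hcard]

theorem Scount_four_mul (b : ℤ) {N : ℕ} (hN : 0 < N) :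
    Scount (4 * b) (4 * N) = 2 * Scount b N := by
  have : NeZero N := ⟨hN.ne'⟩
  have : NeZero (4 * N) := ⟨by omega⟩
  have hlt (y : ZMod N) (i : Fin 2) : 2 * (y.val + i * N) < 4 * N := by
    have := y.val_lt
    have : (i : ℕ) * N ≤ 1 * N := Nat.mul_le_mul_right N (by omega)
    omega
  let f (p : Fin 2 × {y : ZMod N // y ^ 2 = (b : ZMod N)}) :
      {x : ZMod (4 * N) // x ^ 2 = ((4 * b : ℤ) : ZMod (4 * N))} :=
    ⟨((2 * (p.2.1.val + p.1 * N) : ℕ) : ZMod (4 * N)), by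
      obtain ⟨i, y, hy⟩ := p
      have hy' : ((y.val : ℤ) : ZMod N) ^ 2 = b := by simpa using hy
      obtain ⟨c, hc⟩ := (ZMod.intCast_sq_eq_iff _ _ _).1 hy'
      rw [← Int.cast_natCast, ZMod.intCast_sq_eq_iff]
      refine ⟨c + 2 * y.val * i + i ^ 2 * N, ?_⟩
      push_cast
      linear_combination 4 * hc⟩
  have hf : Function.Bijective f := by
    constructor
    · rintro ⟨i, y, hy⟩ ⟨j, z, hz⟩ h
      have h' := congrArg (fun x => ZMod.val x.1) h
      simp only [f, ZMod.val_natCast_of_lt (hlt _ _)] at h'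
      have h1 : y.val + N * i = z.val + N * j := by linarith
      have hyz : y.val = z.val := by
        have := congrArg (· % N) h1
        simpa [Nat.add_mul_mod_self_left, Nat.mod_eq_of_lt (ZMod.val_lt _)] using this
      have hij : i = j := by
        rw [hyz] at h1
        exact Fin.ext (Nat.eq_of_mul_eq_mul_left hN (Nat.add_left_cancel h1))
      obtain rfl := ZMod.val_injective N hyz
      rw [hij]
    · rintro ⟨x, hx⟩
      have hx' : ((x.val : ℤ) : ZMod (4 * N)) ^ 2 = ((4 * b : ℤ) : ZMod (4 * N)) := by
        simpa using hx
      obtain ⟨c, hc⟩ := (ZMod.intCast_sq_eq_iff _ _ _).1 hx'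
      have heven : Even x.val := by
        have : Even ((x.val : ℤ) ^ 2) := ⟨2 * b + 2 * N * c, by push_cast at hc; linarith⟩
        exact_mod_cast (Int.even_pow.1 this).1
      obtain ⟨m, hm⟩ := heven
      have hmN : m < 2 * N := by have := x.val_lt; omega
      have hmb : ((m : ℤ) : ZMod N) ^ 2 = b := by
        rw [ZMod.intCast_sq_eq_iff]
        refine ⟨c, ?_⟩
        rw [hm] at hc
        push_cast at hc
        linarith
      refine ⟨(⟨m / N, (Nat.div_lt_iff_lt_mul hN).2 hmN⟩, ⟨(m : ZMod N), by simpa using hmb⟩),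
        Subtype.ext ?_⟩
      simp only [f, ZMod.val_natCast]
      rw [Nat.mul_comm (m / N), Nat.mod_add_div, two_mul, ← hm, ZMod.natCast_zmod_val]
  rw [Scount, Scount, ← Nat.card_congr (Equiv.ofBijective f hf), Nat.card_prod, Nat.card_fin]

theorem sqrt_count_power_of_two (a : ℤ) :
    Scount a 2 = 1 ∧
    (a % 4 = 0 ∨ a % 4 = 1 → Scount a 4 = 2) ∧
    (a % 4 = 2 ∨ a % 4 = 3 → Scount a 4 = 0) ∧
    ∀ ε : ℕ, 3 ≤ ε →
      (Odd a → (a % 8 = 1 → Scount a (2 ^ ε) = 4) ∧ (a % 8 ≠ 1 → Scount a (2 ^ ε) = 0)) ∧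
      (a % 4 = 2 → Scount a (2 ^ ε) = 0) ∧
      ((4 : ℤ) ∣ a → Scount a (2 ^ ε) = 2 * Scount (a / 4) (2 ^ (ε - 2))) := by
  refine ⟨Scount_two a, Scount_four_eq_two,
    fun h => Scount_eq_zero_of_dvd dvd_rfl (not_four_dvd_sq_sub h), fun ε hε => ?_⟩
  obtain ⟨n, rfl⟩ := Nat.exists_eq_add_of_le' hε
  refine ⟨fun ha => ⟨fun h => Scount_two_pow_eq_four h n, fun h => ?_⟩, fun h => ?_, ?_⟩
  · exact Scount_eq_zero_of_dvd ⟨2 ^ n, by ring⟩ (not_eight_dvd_sq_sub ha h)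
  · exact Scount_eq_zero_of_dvd ⟨2 ^ (n + 1), by ring⟩ (not_four_dvd_sq_sub (Or.inl h))
  · rintro ⟨b, rfl⟩
    have hpow : 2 ^ (n + 3) = 4 * 2 ^ (n + 1) := by ring
    rw [hpow, Scount_four_mul b (by positivity), Int.mul_ediv_cancel_left b (by norm_num)]
    rfl
end

section
/- Let ℓ be a prime, q a positive integer with ℓ ∤ q, d an integer with gcd(d, ℓ) = 1, and t an integer with t² ≠ 4q; write Δ = t² − 4q and ν = v_ℓ(Δ). Let α ≤ β < γ be natural numbers with ℓ^β = gcd(d²q − 1, ℓ^γ), and let κ be a natural number with κ + α + 1 ≤ β. If ℓ^{α+γ+κ} ∣ d²q + 1 − d·t, then ν ≥ 2(α + κ + 1), and the integer Δ/ℓ^{2(α+κ+1)} is congruent to 0 or 1 modulo 4. -/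
/-- If `d` is odd and `d ^ 2 * x` is a square modulo `4`, then `x` is `0` or `1` modulo `4`. -/
theorem emod_four_of_odd_sq_mul {d x a c : ℤ} (hd : d % 2 = 1)
    (h : d ^ 2 * x = a ^ 2 + 4 * c) : x % 4 = 0 ∨ x % 4 = 1 := by
  obtain ⟨e, rfl⟩ : ∃ e, d = 2 * e + 1 := ⟨d / 2, by omega⟩
  have hx : x = a ^ 2 + 4 * (c - (e ^ 2 + e) * x) := by linear_combination h
  rcases Int.even_or_odd' a with ⟨b, rfl | rfl⟩
  · left
    have : x = 4 * (b ^ 2 + (c - (e ^ 2 + e) * x)) := by linear_combination hx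
    omega
  · right
    have : x = 4 * (b ^ 2 + b + (c - (e ^ 2 + e) * x)) + 1 := by linear_combination hx
    omega


theorem discriminant_claim_beta_lt_gamma (ℓ : ℕ) (hℓ : ℓ.Prime) (q : ℤ) (hqpos : 0 < q)
    (hlq : ¬ (ℓ : ℤ) ∣ q) (d : ℤ) (hd : Int.gcd d ℓ = 1)
    (t : ℤ) (ht : t ^ 2 ≠ 4 * q)
    (α β γ : ℕ) (hαβ : α ≤ β) (hβγ : β < γ)
    (hβ : ℓ ^ β = Int.gcd (d ^ 2 * q - 1) ((ℓ : ℤ) ^ γ))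
    (κ : ℕ) (hκ : κ + α + 1 ≤ β)
    (hdvd : (ℓ : ℤ) ^ (α + γ + κ) ∣ d ^ 2 * q + 1 - d * t) :
    2 * (α + κ + 1) ≤ padicValInt ℓ (t ^ 2 - 4 * q) ∧
    ((t ^ 2 - 4 * q) / (ℓ : ℤ) ^ (2 * (α + κ + 1)) % 4 = 0 ∨
      (t ^ 2 - 4 * q) / (ℓ : ℤ) ^ (2 * (α + κ + 1)) % 4 = 1) := by
  have : Fact ℓ.Prime := ⟨hℓ⟩
  have hℓ0 : (ℓ : ℤ) ≠ 0 := by exact_mod_cast hℓ.ne_zero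
  have hA : (ℓ : ℤ) ^ (α + κ + 1) ∣ d ^ 2 * q - 1 := by
    have h : (ℓ : ℤ) ^ β ∣ d ^ 2 * q - 1 := by
      have := Int.gcd_dvd_left (d ^ 2 * q - 1) ((ℓ : ℤ) ^ γ)
      rw [← hβ] at this
      exact_mod_cast this
    exact (pow_dvd_pow _ (by omega)).trans h
  have hN : ((ℓ : ℤ) ^ (α + κ + 1)) ^ 2 ∣ d ^ 2 * q + 1 - d * t := by
    rw [← pow_mul]
    exact (pow_dvd_pow _ (by omega)).trans hdvd
  have hcop : IsCoprime (((ℓ : ℤ) ^ (α + κ + 1)) ^ 2) (d ^ 2) :=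
    (Int.isCoprime_iff_gcd_eq_one.mpr hd).symm.pow_left.pow_left.pow_right
  have hk0 : ((ℓ : ℤ) ^ (α + κ + 1)) ^ 2 ≠ 0 := pow_ne_zero _ (pow_ne_zero _ hℓ0)
  have hℓk : (ℓ : ℤ) ∣ (ℓ : ℤ) ^ (α + κ + 1) := dvd_pow_self _ (by omega)
  have hkodd : Odd (ℓ : ℤ) → Odd ((ℓ : ℤ) ^ (α + κ + 1)) := fun h => h.pow
  have hpow : (ℓ : ℤ) ^ (2 * (α + κ + 1)) = ((ℓ : ℤ) ^ (α + κ + 1)) ^ 2 := by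
    rw [← pow_mul, mul_comm]
  have hval := padicValInt_dvd_iff (p := ℓ) (2 * (α + κ + 1)) (t ^ 2 - 4 * q)
  rw [hpow] at hval ⊢
  generalize (ℓ : ℤ) ^ (α + κ + 1) = k at *
  obtain ⟨a, ha⟩ := hA
  obtain ⟨r, hr⟩ := hN
  have key : d ^ 2 * (t ^ 2 - 4 * q) =
      k ^ 2 * (a ^ 2 - 2 * r * (d ^ 2 * q + 1) + k ^ 2 * r ^ 2) := by
    have hdt : d * t = d ^ 2 * q + 1 - k ^ 2 * r := by linear_combination -hr
    linear_combination (d * t + d ^ 2 * q + 1 - k ^ 2 * r) * hdt +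
      (d ^ 2 * q - 1 + k * a) * ha
  have hdiv : k ^ 2 ∣ t ^ 2 - 4 * q := hcop.dvd_of_dvd_mul_left ⟨_, key⟩
  refine ⟨(hval.mp hdiv).resolve_left (sub_ne_zero.mpr ht), ?_⟩
  obtain ⟨x, hx⟩ := hdiv
  rw [hx, Int.mul_ediv_cancel_left _ hk0]
  rcases hℓ.eq_two_or_odd' with rfl | hodd
  · have hd2 : d % 2 = 1 := by
      rcases Int.emod_two_eq_zero_or_one d with h | h
      · have : (2 : ℤ) ∣ (Int.gcd d (2 : ℕ) : ℤ) :=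
          Int.dvd_coe_gcd (Int.dvd_of_emod_eq_zero h) (by norm_num)
        rw [hd] at this
        norm_num at this
      · exact h
    obtain ⟨j, rfl⟩ := hℓk
    have hcancel : d ^ 2 * x = a ^ 2 - 2 * r * (d ^ 2 * q + 1) + _ :=
      mul_left_cancel₀ hk0 (by rw [← key, hx]; ring)
    push_cast at hcancel ha
    refine emod_four_of_odd_sq_mul (a := a) (c := j ^ 2 * r ^ 2 - r * (j * a + 1)) hd2 ?_
    linear_combination hcancel - 2 * r * ha
  · have hk2 : k % 2 = 1 := Int.odd_iff.mp (hkodd (by exact_mod_cast hodd))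
    exact emod_four_of_odd_sq_mul (a := t) (c := -q) hk2 (by linear_combination -hx)
end

section
/- Let ℓ be a prime, q a positive integer with ℓ ∤ q, d an integer with gcd(d, ℓ) = 1, and t an integer with t² ≠ 4q; write Δ = t² − 4q and ν = v_ℓ(Δ). Let α ≤ γ be natural numbers with ℓ^γ ∣ d²q − 1, and let κ be a natural number with κ < γ − α. If ℓ^{α+γ+κ} ∣ d²q + 1 − d·t, then: (1) ν ≥ 2(α + κ) + 1 and the integer Δ/ℓ^{2(α+κ)} is congruent to 0 or 1 modulo 4; and (2) if moreover κ ≤ γ − α − 2, then ν ≥ 2(α + κ + 1) and the integer Δ/ℓ^{2(α+κ+1)} is congruent to 0 or 1 modulo 4. -/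
/-- Cancelling an odd square preserves the discriminant congruence modulo four. -/
lemma emod_four_of_odd_sq_mul_eq {c D x y : ℤ} (hc : Odd c)
    (h : c ^ 2 * D = x ^ 2 - 4 * y) : D % 4 = 0 ∨ D % 4 = 1 := by
  obtain ⟨k, rfl⟩ := hc
  have hD : D = x ^ 2 - 4 * (y + (k ^ 2 + k) * D) := by linear_combination h
  rcases Int.even_or_odd' x with ⟨m, rfl | rfl⟩
  · left
    rw [hD, show (2 * m) ^ 2 - 4 * (y + (k ^ 2 + k) * D) =
      4 * (m ^ 2 - (y + (k ^ 2 + k) * D)) by ring]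
    omega
  · right
    rw [hD, show (2 * m + 1) ^ 2 - 4 * (y + (k ^ 2 + k) * D) =
      4 * (m ^ 2 + m - (y + (k ^ 2 + k) * D)) + 1 by ring]
    omega

/-- If `d²q` is close to `1` and `dt` is close to `d²q + 1`, then `d²(t² - 4q)` is
`ℓ ^ (2e)` times an integer of the form `x² - 4y`. -/
lemma exists_sq_mul_discrim_eq {ℓ q d t : ℤ} {s γ e : ℕ}
    (hγ : ℓ ^ γ ∣ d ^ 2 * q - 1) (hdvd : ℓ ^ (s + γ) ∣ d ^ 2 * q + 1 - d * t)
    (he : e ≤ γ) (hes : 2 * e ≤ s + γ) :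
    ∃ x y, d ^ 2 * (t ^ 2 - 4 * q) = ℓ ^ (2 * e) * (x ^ 2 - 4 * y) := by
  obtain ⟨a, ha⟩ := (pow_dvd_pow ℓ he).trans hγ
  obtain ⟨b, hb⟩ := (pow_dvd_pow ℓ hes).trans hdvd
  refine ⟨a - ℓ ^ e * b, b, ?_⟩
  have hdt : d * t = d ^ 2 * q + 1 - ℓ ^ (2 * e) * b := by linear_combination -hb
  have hq : d ^ 2 * q = ℓ ^ e * a + 1 := by linear_combination ha
  calc d ^ 2 * (t ^ 2 - 4 * q) = (d * t) ^ 2 - 4 * (d ^ 2 * q) := by ring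
    _ = ℓ ^ (2 * e) * ((a - ℓ ^ e * b) ^ 2 - 4 * b) := by rw [hdt, hq]; ring

lemma discrim_div_emod_four {ℓ : ℕ} (hℓ : ℓ.Prime) {q d t : ℤ} {s γ e : ℕ}
    (hd : Int.gcd d ℓ = 1)
    (hγ : (ℓ : ℤ) ^ γ ∣ d ^ 2 * q - 1)
    (hdvd : (ℓ : ℤ) ^ (s + γ) ∣ d ^ 2 * q + 1 - d * t)
    (he : e ≤ γ) (hes : 2 * e ≤ s + γ) :
    (t ^ 2 - 4 * q) / (ℓ : ℤ) ^ (2 * e) % 4 = 0 ∨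
      (t ^ 2 - 4 * q) / (ℓ : ℤ) ^ (2 * e) % 4 = 1 := by
  obtain ⟨x, y, hxy⟩ := exists_sq_mul_discrim_eq hγ hdvd he hes
  have hcop : IsCoprime d (ℓ : ℤ) := Int.isCoprime_iff_gcd_eq_one.mpr hd
  have hpow : (ℓ : ℤ) ^ (2 * e) ≠ 0 := pow_ne_zero _ (mod_cast hℓ.ne_zero)
  obtain ⟨D, hD⟩ := (hcop.symm.pow (m := 2 * e) (n := 2)).dvd_of_dvd_mul_left ⟨_, hxy⟩
  rw [hD, Int.mul_ediv_cancel_left _ hpow]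
  rcases Int.even_or_odd d with hd_even | hd_odd
  · have hl_odd : Odd (ℓ : ℤ) := by
      rw [← Int.not_even_iff_odd]
      intro hl_even
      have := hcop.isUnit_of_dvd' hd_even.two_dvd hl_even.two_dvd
      norm_num [Int.isUnit_iff] at this
    refine emod_four_of_odd_sq_mul_eq (hl_odd.pow (n := e)) (x := t) (y := q) ?_
    rw [hD]; ring
  · refine emod_four_of_odd_sq_mul_eq hd_odd (x := x) (y := y) (mul_left_cancel₀ hpow ?_)
    rw [← hxy, hD]; ring

lemma le_padicValInt_discrim {ℓ : ℕ} (hℓ : ℓ.Prime) {q d t : ℤ} {s γ n : ℕ}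
    (hd : Int.gcd d ℓ = 1) (ht : t ^ 2 ≠ 4 * q)
    (hγ : (ℓ : ℤ) ^ γ ∣ d ^ 2 * q - 1)
    (hdvd : (ℓ : ℤ) ^ (s + γ) ∣ d ^ 2 * q + 1 - d * t)
    (hn : n ≤ 2 * γ) (hns : n ≤ s + γ) :
    n ≤ padicValInt ℓ (t ^ 2 - 4 * q) := by
  have : Fact ℓ.Prime := ⟨hℓ⟩
  have hcop : IsCoprime d (ℓ : ℤ) := Int.isCoprime_iff_gcd_eq_one.mpr hd
  refine ((padicValInt_dvd_iff n _).mp ?_).resolve_left (sub_ne_zero.mpr ht)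
  refine (hcop.symm.pow (m := n) (n := 2)).dvd_of_dvd_mul_left ?_
  have hsq : (ℓ : ℤ) ^ n ∣ (d ^ 2 * q - 1) ^ 2 :=
    (pow_dvd_pow _ hn).trans (by rw [mul_comm, pow_mul]; exact pow_dvd_pow_of_dvd hγ 2)
  have hlin : (ℓ : ℤ) ^ n ∣ d ^ 2 * q + 1 - d * t := (pow_dvd_pow _ hns).trans hdvd
  rw [show d ^ 2 * (t ^ 2 - 4 * q) = (d ^ 2 * q - 1) ^ 2 -
    (d ^ 2 * q + 1 - d * t) * (d ^ 2 * q + 1 + d * t) by ring]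
  exact dvd_sub hsq (hlin.mul_right _)

theorem discriminant_claim_beta_eq_gamma (ℓ : ℕ) (hℓ : ℓ.Prime) (q : ℤ) (hqpos : 0 < q)
    (hlq : ¬ (ℓ : ℤ) ∣ q) (d : ℤ) (hd : Int.gcd d ℓ = 1)
    (t : ℤ) (ht : t ^ 2 ≠ 4 * q)
    (α γ : ℕ) (hαγ : α ≤ γ) (hγ : (ℓ : ℤ) ^ γ ∣ d ^ 2 * q - 1)
    (κ : ℕ) (hκ : α + κ < γ)
    (hdvd : (ℓ : ℤ) ^ (α + γ + κ) ∣ d ^ 2 * q + 1 - d * t) :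
    (2 * (α + κ) + 1 ≤ padicValInt ℓ (t ^ 2 - 4 * q) ∧
      ((t ^ 2 - 4 * q) / (ℓ : ℤ) ^ (2 * (α + κ)) % 4 = 0 ∨
        (t ^ 2 - 4 * q) / (ℓ : ℤ) ^ (2 * (α + κ)) % 4 = 1)) ∧
    (α + κ + 2 ≤ γ →
      2 * (α + κ + 1) ≤ padicValInt ℓ (t ^ 2 - 4 * q) ∧
      ((t ^ 2 - 4 * q) / (ℓ : ℤ) ^ (2 * (α + κ + 1)) % 4 = 0 ∨
        (t ^ 2 - 4 * q) / (ℓ : ℤ) ^ (2 * (α + κ + 1)) % 4 = 1)) := by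
  rw [add_right_comm] at hdvd
  exact ⟨⟨le_padicValInt_discrim hℓ hd ht hγ hdvd (by omega) (by omega),
      discrim_div_emod_four hℓ hd hγ hdvd (by omega) (by omega)⟩,
    fun _ => ⟨le_padicValInt_discrim hℓ hd ht hγ hdvd (by omega) (by omega),
      discrim_div_emod_four hℓ hd hγ hdvd (by omega) (by omega)⟩⟩
end

section
/- Let ℓ be a prime, q an integer with ℓ ∤ q, d an integer with gcd(d, ℓ) = 1, γ ≥ 1 a natural number with ℓ^γ ∣ d²q − 1, and t an integer with t² ≠ 4q; write Δ = t² − 4q and ν = v_ℓ(Δ). Then ℓ^{2γ} ∣ d²q + 1 − d·t if and only if all three of the following hold: ℓ^{2γ−1} ∣ d²q + 1 − d·t, ν ≥ 2γ, and the integer Δ/ℓ^{2γ} is congruent to 0 or 1 modulo 4. -/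
/-- If the product of `D` with an odd square is a square modulo 4,
then `D` is `0` or `1` modulo 4. -/
theorem emod_four_of_odd_sq_mul_s15 {m D y k : ℤ} (hm : Odd m) (h : m ^ 2 * D = y ^ 2 - 4 * k) :
    D % 4 = 0 ∨ D % 4 = 1 := by
  obtain ⟨n, rfl⟩ := hm
  have hD : D = y ^ 2 - 4 * (k + (n ^ 2 + n) * D) := by linarith
  rcases Int.even_or_odd' y with ⟨z, rfl | rfl⟩
  · left
    have : D = 4 * (z ^ 2 - (k + (n ^ 2 + n) * D)) := by linarith
    omega
  · right
    have : D = 4 * (z ^ 2 + z - (k + (n ^ 2 + n) * D)) + 1 := by linarith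
    omega

/-- If `2 * b = y ^ 2 - m ^ 2 * D` with `m` odd and `D` a discriminant modulo 4,
then `b` is even. -/
theorem two_dvd_of_two_mul_eq_sq_sub {m D y b : ℤ} (hm : Odd m)
    (hD : D % 4 = 0 ∨ D % 4 = 1) (h : 2 * b = y ^ 2 - m ^ 2 * D) : 2 ∣ b := by
  obtain ⟨n, rfl⟩ := hm
  have hb : 2 * b = y ^ 2 - D - 4 * ((n ^ 2 + n) * D) := by linarith
  rcases Int.even_or_odd' y with ⟨z, rfl | rfl⟩
  · have : 2 * b = 4 * (z ^ 2 - (n ^ 2 + n) * D) - D := by linarith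
    omega
  · have : 2 * b = 4 * (z ^ 2 + z - (n ^ 2 + n) * D) + 1 - D := by linarith
    omega

theorem congruence_iff_discriminant_claim (ℓ : ℕ) (hℓ : ℓ.Prime) (q : ℤ)
    (hlq : ¬ (ℓ : ℤ) ∣ q) (d : ℤ) (hd : Int.gcd d ℓ = 1)
    (γ : ℕ) (hγ : 1 ≤ γ) (hdq : (ℓ : ℤ) ^ γ ∣ d ^ 2 * q - 1)
    (t : ℤ) (ht : t ^ 2 ≠ 4 * q) :
    (ℓ : ℤ) ^ (2 * γ) ∣ d ^ 2 * q + 1 - d * t ↔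
      ((ℓ : ℤ) ^ (2 * γ - 1) ∣ d ^ 2 * q + 1 - d * t ∧
        2 * γ ≤ padicValInt ℓ (t ^ 2 - 4 * q) ∧
        ((t ^ 2 - 4 * q) / (ℓ : ℤ) ^ (2 * γ) % 4 = 0 ∨
          (t ^ 2 - 4 * q) / (ℓ : ℤ) ^ (2 * γ) % 4 = 1)) := by
  have : Fact ℓ.Prime := ⟨hℓ⟩
  have hval : 2 * γ ≤ padicValInt ℓ (t ^ 2 - 4 * q) ↔ (ℓ : ℤ) ^ (2 * γ) ∣ t ^ 2 - 4 * q := by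
    rw [padicValInt_dvd_iff, or_iff_right (sub_ne_zero.mpr ht)]
  rw [hval]
  have hcop : IsCoprime d (ℓ : ℤ) := Int.isCoprime_iff_gcd_eq_one.mpr hd
  have hℓ0 : (ℓ : ℤ) ≠ 0 := by exact_mod_cast hℓ.ne_zero
  have hL0 : (ℓ : ℤ) ^ (2 * γ) ≠ 0 := pow_ne_zero _ hℓ0
  have hLL : (ℓ : ℤ) ^ (2 * γ) = (ℓ : ℤ) ^ γ * (ℓ : ℤ) ^ γ := by rw [two_mul, pow_add]
  have hodd : ℓ ≠ 2 → Odd (ℓ : ℤ) := fun h => by exact_mod_cast hℓ.odd_of_ne_two h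
  have hdodd : ℓ = 2 → Odd d := by
    rintro rfl
    exact Int.isCoprime_two_right.mp (by exact_mod_cast hcop)
  obtain ⟨x, hx⟩ := hdq
  have key : d ^ 2 * (t ^ 2 - 4 * q) = (d ^ 2 * q - 1 - (d ^ 2 * q + 1 - d * t)) ^ 2
      - 4 * (d ^ 2 * q + 1 - d * t) := by ring
  rw [hx] at key
  constructor
  · intro h
    refine ⟨(pow_dvd_pow _ (by omega)).trans h, ?_⟩
    obtain ⟨a, ha⟩ := h
    rw [ha] at key
    have key2 : d ^ 2 * (t ^ 2 - 4 * q) =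
        (ℓ : ℤ) ^ (2 * γ) * ((x - (ℓ : ℤ) ^ γ * a) ^ 2 - 4 * a) := by
      rw [key, hLL]; ring
    have hdvd : (ℓ : ℤ) ^ (2 * γ) ∣ t ^ 2 - 4 * q :=
      (hcop.pow (m := 2) (n := 2 * γ)).symm.dvd_of_dvd_mul_left ⟨_, key2⟩
    refine ⟨hdvd, ?_⟩
    obtain ⟨D, hD⟩ := hdvd
    rw [hD, Int.mul_ediv_cancel_left _ hL0]
    by_cases h2 : ℓ = 2
    · refine emod_four_of_odd_sq_mul_s15 (hdodd h2) (y := x - (ℓ : ℤ) ^ γ * a) (k := a) ?_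
      apply mul_left_cancel₀ hL0
      rw [← key2, hD]; ring
    · refine emod_four_of_odd_sq_mul_s15 ((hodd h2).pow (n := γ)) (y := t) (k := q) ?_
      rw [hD, hLL]; ring
  · rintro ⟨⟨b, hb⟩, ⟨D, hD⟩, hmod⟩
    rw [hD, Int.mul_ediv_cancel_left _ hL0] at hmod
    obtain ⟨c, hc⟩ : (ℓ : ℤ) ^ γ ∣ d ^ 2 * q + 1 - d * t :=
      (pow_dvd_pow _ (by omega)).trans ⟨b, hb⟩
    have h4 : 4 * (d ^ 2 * q + 1 - d * t) = (ℓ : ℤ) ^ (2 * γ) * ((x - c) ^ 2 - d ^ 2 * D) := by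
      have e : (ℓ : ℤ) ^ (2 * γ) * (x - c) ^ 2 =
          ((ℓ : ℤ) ^ γ * x - (d ^ 2 * q + 1 - d * t)) ^ 2 := by rw [hLL, hc]; ring
      rw [hD] at key
      linear_combination key - e
    have hs : (ℓ : ℤ) ^ (2 * γ) = (ℓ : ℤ) ^ (2 * γ - 1) * ℓ := by
      rw [← pow_succ]; congr 1; omega
    by_cases h2 : ℓ = 2
    · have hb2 : 2 * b = (x - c) ^ 2 - d ^ 2 * D := by
        apply mul_left_cancel₀ hL0
        rw [← h4, hb, hs, h2]
        push_cast
        ring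
      rw [hb, hs]
      apply mul_dvd_mul_left
      rw [h2]
      exact_mod_cast two_dvd_of_two_mul_eq_sq_sub (hdodd h2) hmod hb2
    · have h24 : IsCoprime ((ℓ : ℤ) ^ (2 * γ)) 4 := by
        have := (Int.isCoprime_two_right.mpr (hodd h2)).pow (m := 2 * γ) (n := 2)
        norm_num at this ⊢
        exact this
      exact h24.dvd_of_dvd_mul_left ⟨_, h4⟩
end

section
/- Let ℓ be a prime and let a be a nonzero element of ℤ/ℓℤ. The number of 2×2 matrices M over ℤ/ℓℤ with det M = a and det(M − I) = 0 (equivalently, with determinant a and having 1 as an eigenvalue) equals ℓ² if a = 1, and equals ℓ·(ℓ + 1) if a ≠ 1. -/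
/-- A `2 × 2` matrix has determinant `a` and eigenvalue `1` iff its trace is `1 + a` and its
off-diagonal entries have product `-(x - 1) (x - a)`, where `x` is the top left entry. -/
def matricesWithDetAndEigenvalueOneEquiv {R : Type*} [CommRing R] (a : R) :
    {M : Matrix (Fin 2) (Fin 2) R // M.det = a ∧ (M - 1).det = 0} ≃
      Σ p : R × R, {c : R // p.2 * c = -((p.1 - 1) * (p.1 - a))} where
  toFun M := ⟨(M.1 0 0, M.1 0 1), M.1 1 0, by
    obtain ⟨M, h₁, h₂⟩ := M
    simp only [Matrix.det_fin_two, Matrix.sub_apply, Matrix.one_apply_eq, ne_eq, zero_ne_one,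
      one_ne_zero, not_false_eq_true, Matrix.one_apply_ne, sub_zero] at h₁ h₂ ⊢
    linear_combination (M 0 0 - 1) * h₁ - M 0 0 * h₂⟩
  invFun p := ⟨!![p.1.1, p.1.2; p.2.1, 1 + a - p.1.1], by
    obtain ⟨⟨x, b⟩, c, h⟩ := p
    simp only [Matrix.det_fin_two, Matrix.sub_apply, Matrix.one_apply_eq, ne_eq, zero_ne_one,
      one_ne_zero, not_false_eq_true, Matrix.one_apply_ne, sub_zero, Matrix.of_apply,
      Matrix.cons_val', Matrix.cons_val_zero, Matrix.cons_val_one, Matrix.cons_val_fin_one] at h ⊢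
    constructor <;> linear_combination -h⟩
  left_inv M := by
    obtain ⟨M, h₁, h₂⟩ := M
    ext i j
    simp only [Matrix.det_fin_two, Matrix.sub_apply, Matrix.one_apply_eq, ne_eq, zero_ne_one,
      one_ne_zero, not_false_eq_true, Matrix.one_apply_ne, sub_zero] at h₁ h₂
    fin_cases i <;> fin_cases j <;> simp
    linear_combination h₂ - h₁
  right_inv p := by simp

/-- The number of solutions `c` of a linear equation `b * c = t` over a field. -/
theorem Nat.card_mul_left_eq {F : Type*} [Field F] [DecidableEq F] (b t : F) :
    Nat.card {c : F // b * c = t} =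
      if b = 0 then (if t = 0 then Nat.card F else 0) else 1 := by
  split_ifs with hb ht
  · subst hb ht
    exact Nat.card_congr (Equiv.subtypeUnivEquiv fun c => zero_mul c)
  · subst hb
    have : IsEmpty {c : F // 0 * c = t} := ⟨fun c => ht (by simpa using c.2.symm)⟩
    exact Nat.card_of_isEmpty
  · rw [Nat.card_eq_one_iff_unique]
    exact ⟨⟨fun c d => Subtype.ext (mul_left_cancel₀ hb (c.2.trans d.2.symm))⟩,
      ⟨t / b, mul_div_cancel₀ t hb⟩⟩

theorem card_matrices_det_eq_and_eigenvalue_one {F : Type*} [Field F] [Fintype F]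
    [DecidableEq F] (a : F) :
    Nat.card {M : Matrix (Fin 2) (Fin 2) F // M.det = a ∧ (M - 1).det = 0} =
      Fintype.card F * (({1, a} : Finset F).card + (Fintype.card F - 1)) := by
  have key (x : F) : (-((x - 1) * (x - a)) = 0) ↔ x ∈ ({1, a} : Finset F) := by
    simp [sub_eq_zero]
  rw [Nat.card_congr (matricesWithDetAndEigenvalueOneEquiv a), Nat.card_sigma,
    Fintype.sum_prod_type]
  simp only [Nat.card_mul_left_eq, key]
  simp only [Nat.card_eq_fintype_card]
  have inner (n : ℕ) : ∑ b : F, (if b = 0 then n else 1) = n + (Fintype.card F - 1) := by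
    rw [Fintype.sum_eq_add_sum_compl 0, if_pos rfl,
      Finset.sum_congr rfl fun b hb => if_neg (by simpa using hb)]
    simp [Finset.card_compl]
  simp only [inner, Finset.sum_add_distrib, Finset.sum_ite_mem, Finset.univ_inter,
    Finset.sum_const, smul_eq_mul, Finset.card_univ]
  ring

theorem count_matrices_with_eigenvalue_one (ℓ : ℕ) (hℓ : ℓ.Prime) (a : ZMod ℓ)
    (ha : a ≠ 0) :
    Nat.card {M : Matrix (Fin 2) (Fin 2) (ZMod ℓ) // M.det = a ∧ (M - 1).det = 0} =
      if a = 1 then ℓ ^ 2 else ℓ * (ℓ + 1) := by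
  have : Fact ℓ.Prime := ⟨hℓ⟩
  have hpos := hℓ.pos
  rw [card_matrices_det_eq_and_eigenvalue_one, ZMod.card]
  split_ifs with h
  · rw [h, Finset.pair_eq_singleton, Finset.card_singleton, Nat.add_sub_cancel' hpos, sq]
  · rw [Finset.card_pair (Ne.symm h)]
    congr 1
    omega
end

section
/- Let G be a finite abelian group of rank at most 2, i.e. G is isomorphic as a group to (ℤ/n₁ℤ) × (ℤ/n₂ℤ) for some positive integers n₁, n₂. Let ℓ be a prime and let d ≤ e be natural numbers. If there exists an injective group homomorphism (ℤ/ℓ^dℤ) × (ℤ/ℓ^dℤ) → G and ℓ^{2e−1} divides the order of G, then there exists an injective group homomorphism (ℤ/ℓ^eℤ) × (ℤ/ℓ^dℤ) → G. -/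
theorem ZMod.exists_injective_addMonoidHom_of_dvd {m n : ℕ} (hn : 0 < n) (h : m ∣ n) :
    ∃ f : ZMod m →+ ZMod n, Function.Injective f := by
  obtain ⟨k, rfl⟩ := h
  have hk : (k : ℤ) ≠ 0 := by
    rintro h
    simp_all
  refine ⟨ZMod.lift m ⟨zmultiplesHom _ (k : ZMod (m * k)), ?_⟩,
    (ZMod.lift_injective m).2 fun j hj ↦ ?_⟩
  · simpa only [zmultiplesHom_apply, natCast_zsmul, nsmul_eq_mul, Nat.cast_mul] using
      ZMod.natCast_self (m * k)
  · have hj' : ((j * k : ℤ) : ZMod (m * k)) = 0 := by simpa using hj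
    rw [ZMod.intCast_zmod_eq_zero_iff_dvd] at hj' ⊢
    push_cast at hj'
    exact Int.dvd_of_mul_dvd_mul_right hk hj'

theorem ZMod.card_ker_nsmulAddMonoidHom (n m : ℕ) [NeZero n] :
    Nat.card (nsmulAddMonoidHom m : ZMod n →+ ZMod n).ker = n.gcd m := by
  simpa using IsAddCyclic.card_nsmulAddMonoidHom_ker (G := ZMod n) m

theorem ZMod.dvd_and_dvd_of_injective {m n₁ n₂ : ℕ} (hm : 0 < m) (h₁ : 0 < n₁) (h₂ : 0 < n₂)
    (f : ZMod m × ZMod m →+ ZMod n₁ × ZMod n₂) (hf : Function.Injective f) :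
    m ∣ n₁ ∧ m ∣ n₂ := by
  have : NeZero n₁ := ⟨h₁.ne'⟩
  have : NeZero n₂ := ⟨h₂.ne'⟩
  have hker (x : ZMod m × ZMod m) : m • f x = 0 := by
    have hx : m • x = 0 := by ext <;> simp
    rw [← map_nsmul, hx, map_zero]
  let g (x : ZMod m × ZMod m) : (nsmulAddMonoidHom m : ZMod n₁ →+ ZMod n₁).ker ×
      (nsmulAddMonoidHom m : ZMod n₂ →+ ZMod n₂).ker :=
    (⟨(f x).1, congrArg Prod.fst (hker x)⟩, ⟨(f x).2, congrArg Prod.snd (hker x)⟩)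
  have hg : Function.Injective g := fun x y hxy ↦ hf <|
    Prod.ext (congrArg (fun z ↦ (z.1 : ZMod n₁)) hxy) (congrArg (fun z ↦ (z.2 : ZMod n₂)) hxy)
  have hcard := Nat.card_le_card_of_injective g hg
  rw [Nat.card_prod, Nat.card_prod, Nat.card_zmod, ZMod.card_ker_nsmulAddMonoidHom,
    ZMod.card_ker_nsmulAddMonoidHom] at hcard
  have hle₁ := Nat.gcd_le_right n₁ hm
  have hle₂ := Nat.gcd_le_right n₂ hm
  rw [← Nat.gcd_eq_right_iff_dvd, ← Nat.gcd_eq_right_iff_dvd]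
  constructor <;> nlinarith

theorem Nat.Prime.pow_dvd_or_pow_dvd_of_pow_dvd_mul {p a b e : ℕ} (hp : p.Prime) (ha : a ≠ 0)
    (hb : b ≠ 0) (h : p ^ (2 * e - 1) ∣ a * b) : p ^ e ∣ a ∨ p ^ e ∣ b := by
  rw [hp.pow_dvd_iff_le_factorization (mul_ne_zero ha hb), Nat.factorization_mul ha hb,
    Finsupp.add_apply] at h
  rw [hp.pow_dvd_iff_le_factorization ha, hp.pow_dvd_iff_le_factorization hb]
  omega

theorem embed_of_dvd_card (G : Type*) [AddCommGroup G] [Finite G]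
    (hrank : ∃ n₁ n₂ : ℕ, 0 < n₁ ∧ 0 < n₂ ∧ Nonempty (G ≃+ (ZMod n₁ × ZMod n₂)))
    (ℓ : ℕ) (hℓ : ℓ.Prime) (d e : ℕ) (hde : d ≤ e)
    (hembed : ∃ f : (ZMod (ℓ ^ d) × ZMod (ℓ ^ d)) →+ G, Function.Injective f)
    (hdvd : ℓ ^ (2 * e - 1) ∣ Nat.card G) :
    ∃ f : (ZMod (ℓ ^ e) × ZMod (ℓ ^ d)) →+ G, Function.Injective f := by
  obtain ⟨n₁, n₂, h₁, h₂, ⟨φ⟩⟩ := hrank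
  obtain ⟨f, hf⟩ := hembed
  obtain ⟨hd₁, hd₂⟩ := ZMod.dvd_and_dvd_of_injective (pow_pos hℓ.pos d) h₁ h₂
    (φ.toAddMonoidHom.comp f) (φ.injective.comp hf)
  rw [Nat.card_congr φ.toEquiv, Nat.card_prod, Nat.card_zmod, Nat.card_zmod] at hdvd
  obtain he | he := hℓ.pow_dvd_or_pow_dvd_of_pow_dvd_mul h₁.ne' h₂.ne' hdvd
  · obtain ⟨u, hu⟩ := ZMod.exists_injective_addMonoidHom_of_dvd h₁ he
    obtain ⟨v, hv⟩ := ZMod.exists_injective_addMonoidHom_of_dvd h₂ hd₂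
    exact ⟨φ.symm.toAddMonoidHom.comp (u.prodMap v), φ.symm.injective.comp (hu.prodMap hv)⟩
  · obtain ⟨u, hu⟩ := ZMod.exists_injective_addMonoidHom_of_dvd h₂ he
    obtain ⟨v, hv⟩ := ZMod.exists_injective_addMonoidHom_of_dvd h₁ hd₁
    exact ⟨φ.symm.toAddMonoidHom.comp ((AddEquiv.prodComm (M := ZMod n₂) (N := ZMod n₁)).toAddMonoidHom.comp
      (u.prodMap v)),
      φ.symm.injective.comp (AddEquiv.prodComm.injective.comp (hu.prodMap hv))⟩
end
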